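/- arXiv:1506.02435 — 3 statements merged into one kernel-verified Lean document; each statement's English description precedes it below -/
import Mathlib

section
/- Let Γ be an n-vertex connected nonregular finite simple graph whose adjacency matrix has exactly three distinct eigenvalues s > 1 > −t, which is not a cone and not biregular, and suppose t ≥ 11. Then the minimum vertex degree satisfies δ(Γ) ≥ t + 3. -/
section AuxiliaryResults

open Finset
open scoped Matrix MatrixOrder

theorem Matrix.IsHermitian.aeval_eq_zero_of_spectrum {n : Type*} [Fintype n] [DecidableEq n]
    {A : Matrix n n ℝ} (hA : A.IsHermitian) (q : Polynomial ℝ)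
    (hq : ∀ x ∈ spectrum ℝ A, q.eval x = 0) : Polynomial.aeval A q = 0 := by
  have hA' : IsSelfAdjoint A := hA
  rw [← cfc_polynomial (p := IsSelfAdjoint) q A hA', cfc_congr (g := fun _ => 0) fun x hx => hq x hx,
    cfc_const_zero]

theorem Matrix.IsHermitian.posSemidef_smul_one_sub {n : Type*} [Fintype n] [DecidableEq n]
    {A : Matrix n n ℝ} (hA : A.IsHermitian) {s : ℝ} (hs : ∀ x ∈ spectrum ℝ A, x ≤ s) :
    (s • (1 : Matrix n n ℝ) - A).PosSemidef := by
  rw [Matrix.posSemidef_iff_isHermitian_and_spectrum_nonneg]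
  refine ⟨(Matrix.isHermitian_one.smul (by simp [IsSelfAdjoint])).sub hA, ?_⟩
  rw [← Algebra.algebraMap_eq_smul_one, ← spectrum.singleton_sub_eq]
  rintro _ ⟨x, hx, y, hy, rfl⟩
  rw [Set.mem_singleton_iff.1 hx]
  simpa using hs y hy

theorem Matrix.isIntegral_of_mem_spectrum_map {n : Type*} [Fintype n] [DecidableEq n]
    (B : Matrix n n ℤ) {x : ℝ} (hx : x ∈ spectrum ℝ (B.map (Int.cast : ℤ → ℝ))) :
    IsIntegral ℤ x := by
  refine ⟨B.charpoly, B.charpoly_monic, ?_⟩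
  rw [Matrix.mem_spectrum_iff_isRoot_charpoly] at hx
  have := B.charpoly_map (Int.castRingHom ℝ)
  rw [Polynomial.IsRoot, show B.map (Int.cast : ℤ → ℝ) = (Int.castRingHom ℝ).mapMatrix B from rfl] at hx
  simp_all [Polynomial.eval_map]

theorem exists_int_eq_of_isIntegral {x : ℝ} (hx : IsIntegral ℤ x) {a b : ℤ} (ha : a ≠ 0)
    (h : a * x = b) : ∃ k : ℤ, x = k := by
  have hx' : x = algebraMap ℚ ℝ (b / a) := by
    have : (a : ℝ) ≠ 0 := by exact_mod_cast ha
    rw [eq_ratCast]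
    push_cast
    field_simp
    linarith
  rw [hx', isIntegral_algebraMap_iff (algebraMap ℚ ℝ).injective] at hx
  obtain ⟨k, hk⟩ := IsIntegrallyClosed.isIntegral_iff.1 hx
  exact ⟨k, by rw [hx', ← hk]; simp⟩

namespace SimpleGraph

variable {V : Type*} [Fintype V] [DecidableEq V]

/-- `A ^ 2 + (t - 1) A - t = m z zᵀ` for the adjacency matrix `A` of `G`, over the integers. -/
def IsRankOneQuadratic (G : SimpleGraph V) [DecidableRel G.Adj] (t m : ℤ) (z : V → ℤ) : Prop :=
  ∀ u w, (#(G.neighborFinset u ∩ G.neighborFinset w) : ℤ) + (t - 1) * (if G.Adj u w then 1 else 0)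
    - (if u = w then t else 0) = m * z u * z w

namespace IsRankOneQuadratic

variable {G : SimpleGraph V} [DecidableRel G.Adj] {t m : ℤ} {z : V → ℤ}

theorem degree_eq (h : G.IsRankOneQuadratic t m z) (u : V) :
    (G.degree u : ℤ) = m * z u ^ 2 + t := by
  have := h u u
  simp at this
  linarith

theorem card_of_adj (h : G.IsRankOneQuadratic t m z) {u w : V} (huw : G.Adj u w) :
    (#(G.neighborFinset u ∩ G.neighborFinset w) : ℤ) = m * z u * z w - (t - 1) := by
  have := h u w
  simp [huw, huw.ne] at this
  linarith

theorem card_of_not_adj (h : G.IsRankOneQuadratic t m z) {u w : V} (hne : u ≠ w)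
    (huw : ¬ G.Adj u w) :
    (#(G.neighborFinset u ∩ G.neighborFinset w) : ℤ) = m * z u * z w := by
  have := h u w
  simp [huw, hne] at this
  linarith

theorem mul_le_of_adj (h : G.IsRankOneQuadratic t m z) {u w : V} (huw : G.Adj u w) :
    m * z u * z w ≤ m * z w ^ 2 + 2 * t - 2 := by
  have h1 : #(G.neighborFinset u ∩ G.neighborFinset w) < G.degree w := by
    rw [← G.card_neighborFinset_eq_degree w]
    refine card_lt_card ⟨inter_subset_right, fun hs => ?_⟩
    have := hs ((G.mem_neighborFinset w u).2 huw.symm)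
    simp at this
  have := h.card_of_adj huw
  have := h.degree_eq w
  zify at h1
  linarith

theorem mul_le_of_not_adj (h : G.IsRankOneQuadratic t m z) {u w : V} (hne : u ≠ w)
    (huw : ¬ G.Adj u w) : m * z u * z w ≤ m * z w ^ 2 + t := by
  have h1 : #(G.neighborFinset u ∩ G.neighborFinset w) ≤ G.degree w := by
    rw [← G.card_neighborFinset_eq_degree w]
    exact card_le_card inter_subset_right
  have := h.card_of_not_adj hne huw
  have := h.degree_eq w
  zify at h1
  linarith

theorem le_mul_of_adj (h : G.IsRankOneQuadratic t m z) {u w : V} (huw : G.Adj u w) :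
    t - 1 ≤ m * z u * z w := by
  have := h.card_of_adj huw
  have : (0 : ℤ) ≤ #(G.neighborFinset u ∩ G.neighborFinset w) := by positivity
  linarith

/-- The quadratic matrix equation, applied to a vector. -/
theorem sum_sum (h : G.IsRankOneQuadratic t m z) (f : V → ℤ) (y : V) :
    ∑ u ∈ G.neighborFinset y, ∑ x ∈ G.neighborFinset u, f x
      = m * z y * ∑ x, z x * f x - (t - 1) * ∑ u ∈ G.neighborFinset y, f u + t * f y := by
  have h1 : ∑ u ∈ G.neighborFinset y, ∑ x ∈ G.neighborFinset u, f x
      = ∑ x, (#(G.neighborFinset y ∩ G.neighborFinset x) : ℤ) * f x := by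
    rw [Finset.sum_comm' (t' := univ) (s' := fun x => G.neighborFinset y ∩ G.neighborFinset x)]
    · simp
    · simp [adj_comm]
  have h2 : ∀ x, (#(G.neighborFinset y ∩ G.neighborFinset x) : ℤ) * f x
      = m * z y * (z x * f x) - (t - 1) * (if G.Adj y x then f x else 0)
        + t * (if y = x then f x else 0) := by
    intro x
    have := h y x
    split_ifs at * <;> linear_combination f x * this
  rw [h1, sum_congr rfl fun x _ => h2 x, sum_add_distrib, sum_sub_distrib, ← mul_sum, ← mul_sum,
    ← mul_sum, ← sum_filter, ← neighborFinset_eq_filter]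
  simp

/-- `z` is an eigenvector; the eigenvalue is read off at a vertex `v` with `z v = 1`. -/
theorem sum_neighbor (h : G.IsRankOneQuadratic t m z) (hm : m ≠ 0) {v : V} (hv : z v = 1) (y : V) :
    ∑ u ∈ G.neighborFinset y, z u = z y * ∑ u ∈ G.neighborFinset v, z u := by
  set f : V → ℤ := fun x => if x = v then 1 else 0
  set c := ∑ x, z x * ∑ w ∈ G.neighborFinset x, f w
  have hf : ∑ x, z x * f x = 1 := by simp [f, hv]
  have key : ∀ y, ∑ u ∈ G.neighborFinset y, z u = z y * c := by
    intro y
    have h1 := h.sum_sum (fun u => ∑ w ∈ G.neighborFinset u, f w) y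
    simp only [h.sum_sum f, hf, mul_one] at h1
    rw [sum_add_distrib, sum_sub_distrib, ← mul_sum, ← mul_sum, ← mul_sum, h.sum_sum f, hf] at h1
    apply mul_left_cancel₀ hm
    linear_combination h1
  rw [key y, key v, hv, one_mul]

/-- A combination of the equations at `y` and at a vertex `v` with `z v = 1` that involves no global
quantity. -/
theorem sum_quadratic (h : G.IsRankOneQuadratic t m z) (hm : m ≠ 0) {v : V} (hv : z v = 1)
    (c d : ℤ) (y : V) :
    m * ∑ u ∈ G.neighborFinset y, (z u - c) * (z u - d)
        - z y * (m * ∑ u ∈ G.neighborFinset v, (z u - c) * (z u - d))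
      = (z y - 1) * (2 * t * (t - 1) - (2 * t - 1) * (m * z y) + m * c * d * (m * z y - t)) := by
  have hexp : ∀ x, m * ∑ u ∈ G.neighborFinset x, (z u - c) * (z u - d)
      = m * z x * ∑ u, z u - (2 * t - 1) * (m * z x ^ 2) - 2 * t * (t - 1)
        - m * (c + d) * (z x * ∑ u ∈ G.neighborFinset v, z u) + m * c * d * (m * z x ^ 2 + t) := by
    intro x
    have h1 := h.sum_sum (fun _ => 1) x
    simp only [sum_const, nsmul_eq_mul, mul_one, card_neighborFinset_eq_degree,
      h.degree_eq] at h1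
    rw [sum_add_distrib, ← mul_sum] at h1
    simp only [sum_const, nsmul_eq_mul, card_neighborFinset_eq_degree, h.degree_eq] at h1
    rw [← h.sum_neighbor hm hv x]
    have h2 : ∑ u ∈ G.neighborFinset x, (z u - c) * (z u - d)
        = ∑ u ∈ G.neighborFinset x, z u ^ 2 - (c + d) * ∑ u ∈ G.neighborFinset x, z u
          + c * d * (m * z x ^ 2 + t) := by
      have : (∑ u ∈ G.neighborFinset x, c * d) = c * d * (m * z x ^ 2 + t) := by
        rw [sum_const, nsmul_eq_mul, card_neighborFinset_eq_degree, h.degree_eq, mul_comm]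
      rw [← this, mul_sum, ← sum_sub_distrib, ← sum_add_distrib]
      exact sum_congr rfl fun u _ => by ring
    rw [h2]
    linear_combination h1
  rw [hexp y, hexp v, hv]
  ring

section SmallDegree

variable {v : V}

theorem le_mul_of_adj_base (h : G.IsRankOneQuadratic t m z) (hv : z v = 1) {u : V}
    (hu : G.Adj v u) : t - 1 ≤ m * z u := by
  simpa [hv] using h.le_mul_of_adj hu

theorem mul_le_of_not_adj_base (h : G.IsRankOneQuadratic t m z) (hv : z v = 1) {u : V}
    (hne : u ≠ v) (hu : ¬ G.Adj v u) : m * z u ≤ t + m := by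
  have h1 := h.mul_le_of_not_adj hne (fun h => hu h.symm)
  rw [hv] at h1
  linarith

/-- No value of `z` lies strictly between `1` and roughly `t / m`. -/
theorem le_mul_of_ne_one (h : G.IsRankOneQuadratic t m z) (hv : z v = 1) (hm : m = 1 ∨ m = 2)
    (ht : 11 ≤ t) (hpos : ∀ u, 0 < z u) {w : V} (hw : z w ≠ 1) : t - 3 ≤ m * z w := by
  by_cases hvw : G.Adj v w
  · linarith [h.le_mul_of_adj_base hv hvw]
  have hne : w ≠ v := by rintro rfl; exact hw hv
  by_contra! hlt
  have hw2 : 2 ≤ z w := by have := hpos w; omega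
  have hm0 : 0 < m := by omega
  set S := ∑ u ∈ G.neighborFinset v, z u with hS
  have hcv : (#(G.neighborFinset v) : ℤ) = t + m := by
    rw [card_neighborFinset_eq_degree, h.degree_eq, hv]; ring
  have hcw : (#(G.neighborFinset w) : ℤ) = m * z w ^ 2 + t := by
    rw [card_neighborFinset_eq_degree, h.degree_eq]
  have hI := h.card_of_not_adj hne.symm hvw
  rw [hv, mul_one] at hI
  have hcv' := card_inter_add_card_sdiff (G.neighborFinset v) (G.neighborFinset w)
  have hcw' := card_inter_add_card_sdiff (G.neighborFinset w) (G.neighborFinset v)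
  have hsv := sum_inter_add_sum_sdiff (G.neighborFinset v) (G.neighborFinset w) z
  have hsw := sum_inter_add_sum_sdiff (G.neighborFinset w) (G.neighborFinset v) z
  rw [inter_comm (G.neighborFinset w)] at hcw' hsw
  have hSlow : (t + m) * (t - 1) ≤ m * S := by
    rw [← hcv, hS, mul_sum, ← nsmul_eq_mul]
    exact card_nsmul_le_sum _ _ _ fun u hu =>
      h.le_mul_of_adj_base hv ((G.mem_neighborFinset v u).1 hu)
  have h1 : (#(G.neighborFinset v \ G.neighborFinset w) : ℤ) * (t - 1)
      ≤ m * ∑ u ∈ G.neighborFinset v \ G.neighborFinset w, z u := by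
    rw [mul_sum, ← nsmul_eq_mul]
    exact card_nsmul_le_sum _ _ _ fun u hu =>
      h.le_mul_of_adj_base hv ((G.mem_neighborFinset v u).1 (mem_sdiff.1 hu).1)
  have h2 : m * ∑ u ∈ G.neighborFinset w \ G.neighborFinset v, z u
      ≤ (#(G.neighborFinset w \ G.neighborFinset v) : ℤ) * (t + m) := by
    rw [mul_sum, ← nsmul_eq_mul]
    refine sum_le_card_nsmul _ _ _ fun u hu => ?_
    simp only [mem_sdiff, mem_neighborFinset] at hu
    refine h.mul_le_of_not_adj_base hv ?_ hu.2
    rintro rfl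
    exact hvw hu.1.symm
  rw [h.sum_neighbor hm0.ne' hv w, ← hS] at hsw
  rw [← hS] at hsv
  zify at hcv' hcw'
  rw [hcv] at hcv'
  rw [hcw] at hcw'
  have e1 : (#(G.neighborFinset v \ G.neighborFinset w) : ℤ) = t + m - m * z w := by linarith
  have e2 : (#(G.neighborFinset w \ G.neighborFinset v) : ℤ) = m * z w ^ 2 + t - m * z w := by
    linarith
  rw [e1] at h1
  rw [e2] at h2
  have h3 : m * S * (z w - 1) ≤
      (m * z w ^ 2 + t - m * z w) * (t + m) - (t + m - m * z w) * (t - 1) := by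
    have : m * (z w * S) = m * S + m * ∑ u ∈ G.neighborFinset w \ G.neighborFinset v, z u
        - m * ∑ u ∈ G.neighborFinset v \ G.neighborFinset w, z u := by
      rw [← hsw, ← hsv]; ring
    linarith
  have h4 : (t + m) * (t - 1) * (z w - 1) ≤ m * S * (z w - 1) :=
    mul_le_mul_of_nonneg_right hSlow (by linarith)
  have h5 : z w * t * (t - 1) ≤ (m * z w * (z w - 1) + t) * (t + m) := by linarith
  have h6 : 0 ≤ (z w - 2) * (t - 4 - m * z w) := mul_nonneg (by linarith) (by linarith)
  rcases hm with rfl | rfl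
  · nlinarith
  · nlinarith

theorem not_exists_not_adj (h : G.IsRankOneQuadratic t m z) (hv : z v = 1) (hm : m = 1 ∨ m = 2)
    (ht : 11 ≤ t) (hpos : ∀ u, 0 < z u) : ¬ ∃ w, w ≠ v ∧ ¬ G.Adj v w := by
  rintro ⟨w, hwv, hvw⟩
  have hm0 : 0 < m := by omega
  have hnb : ∀ {x u}, z x = 1 → G.Adj x u → z u ≠ 1 := by
    intro x u hx hxu hu
    have := h.le_mul_of_adj_base hx hxu
    rw [hu] at this
    omega
  have hY : ∃ y, z y ≠ 1 ∧ m * z y ≤ t + m := by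
    by_cases hw : z w = 1
    · have h1 := h.card_of_not_adj hwv.symm hvw
      have h2 := h.degree_eq w
      rw [hv, hw] at h1
      rw [hw, ← card_neighborFinset_eq_degree] at h2
      obtain ⟨y, hy⟩ : (G.neighborFinset w \ G.neighborFinset v).Nonempty := by
        rw [sdiff_nonempty]
        intro hs
        rw [inter_eq_right.2 hs] at h1
        linarith
      simp only [mem_sdiff, mem_neighborFinset] at hy
      refine ⟨y, hnb hw hy.1, h.mul_le_of_not_adj_base hv ?_ hy.2⟩
      rintro rfl
      exact hvw hy.1.symm
    · exact ⟨w, hw, h.mul_le_of_not_adj_base hv hwv hvw⟩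
  obtain ⟨y, hy1, hymin⟩ : ∃ y, z y ≠ 1 ∧ ∀ u, z u ≠ 1 → z y ≤ z u := by
    obtain ⟨y₀, h₀, -⟩ := hY
    obtain ⟨y, hy, hmin⟩ := exists_min_image (univ.filter fun u => z u ≠ 1) z ⟨y₀, by simpa⟩
    exact ⟨y, by simpa using hy, fun u hu => hmin u (by simpa)⟩
  have hyup : m * z y ≤ t + m := by
    obtain ⟨y₀, h₀, h₀'⟩ := hY
    nlinarith [hymin y₀ h₀]
  have hylow := h.le_mul_of_ne_one hv hm ht hpos hy1
  have hdiff : ∀ u, m * z y * (z u - z y) ≤ 2 * t - 2 := by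
    intro u
    rcases eq_or_ne u y with rfl | hne
    · simp; linarith
    by_cases hu : G.Adj u y
    · nlinarith [h.mul_le_of_adj hu]
    · nlinarith [h.mul_le_of_not_adj hne hu]
  have hid := h.sum_quadratic hm0.ne' hv
  set a := z y with ha
  rcases le_or_gt (m * a) (t - 1) with hcase | hcase
  · have hup : ∀ u, z u ≤ a + 2 := by
      intro u
      by_contra! hu
      have := hdiff u
      nlinarith
    have hLv : ∑ u ∈ G.neighborFinset v, (z u - a) * (z u - (a + 2)) ≤ 0 := by
      refine sum_nonpos fun u hu => ?_
      have := hymin u (hnb hv ((G.mem_neighborFinset v u).1 hu))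
      have := hup u
      exact mul_nonpos_of_nonneg_of_nonpos (by linarith) (by linarith)
    have hLy : -(m * a ^ 2 + t) ≤ ∑ u ∈ G.neighborFinset y, (z u - a) * (z u - (a + 2)) := by
      rw [ha, ← h.degree_eq y, ← card_neighborFinset_eq_degree, ← mul_neg_one, ← nsmul_eq_mul]
      refine card_nsmul_le_sum _ _ _ fun u _ => ?_
      nlinarith [sq_nonneg (z u - z y - 1)]
    have key := hid a (a + 2) y
    rw [← ha] at key
    have hrhs : -(m * (m * a ^ 2 + t)) ≤ (a - 1) *
        (2 * t * (t - 1) - (2 * t - 1) * (m * a) + m * a * (a + 2) * (m * a - t)) := by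
      rw [← key]
      have : a * (m * ∑ u ∈ G.neighborFinset v, (z u - a) * (z u - (a + 2))) ≤ 0 :=
        mul_nonpos_of_nonneg_of_nonpos (hpos y).le
          (mul_nonpos_of_nonneg_of_nonpos hm0.le hLv)
      nlinarith
    clear_value a
    obtain h1 | h1 | h1 : t = m * a + 1 ∨ t = m * a + 2 ∨ t = m * a + 3 := by omega
    all_goals
      subst h1
      rcases hm with rfl | rfl
      all_goals
        obtain ⟨b, rfl⟩ : ∃ b, a = b + 4 := ⟨a - 4, by ring⟩
        have hb : 0 ≤ b := by omega
        nlinarith [mul_nonneg hb hb, mul_nonneg hb (mul_nonneg hb hb)]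
  · have hup : ∀ u, z u ≤ a + 1 := by
      intro u
      by_contra! hu
      have := hdiff u
      nlinarith
    have hz : ∀ u, (z u - a) * (z u - (a + 1)) = if z u = 1 then (a - 1) * a else 0 := by
      intro u
      split_ifs with hu
      · rw [hu]; ring
      · have := hymin u hu
        have := hup u
        obtain h1 | h1 : z u = a ∨ z u = a + 1 := by omega
        all_goals rw [h1]; ring
    have key := hid a (a + 1) y
    have hLv : ∑ u ∈ G.neighborFinset v, (z u - a) * (z u - (a + 1)) = 0 :=
      sum_eq_zero fun u hu => by rw [hz, if_neg (hnb hv ((G.mem_neighborFinset v u).1 hu))]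
    rw [hLv, ← ha] at key
    simp only [hz] at key
    rw [← sum_filter, sum_const, nsmul_eq_mul] at key
    set p : ℤ := (#((G.neighborFinset y).filter fun u => z u = 1) : ℤ) with hp
    have hp0 : 0 ≤ p := by positivity
    clear_value p a
    have ha1 : a - 1 ≠ 0 := by omega
    have key' : m * p * a
        = 2 * t * (t - 1) - (2 * t - 1) * (m * a) + m * a * (a + 1) * (m * a - t) := by
      apply mul_left_cancel₀ ha1
      linear_combination key
    have hd : m * a ∣ 2 * t * (t - 1) :=
      ⟨p + (2 * t - 1) - (a + 1) * (m * a - t), by linear_combination -key'⟩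
    obtain h1 | h1 | h1 : t = m * a ∨ t = m * a - 1 ∨ t = m * a - 2 := by omega
    · rw [← h1] at key'
      have : p * t = -t := by rw [h1] at key' ⊢; linear_combination key'
      nlinarith
    · have h4 : m * a ∣ 4 := by
        have hk : 2 * t * (t - 1) - m * a * (2 * (m * a) - 6) = 4 := by rw [h1]; ring
        exact hk ▸ dvd_sub hd (Dvd.intro _ rfl)
      have := Int.le_of_dvd (by norm_num) h4
      omega
    · have h12 : m * a ∣ 12 := by
        have hk : 2 * t * (t - 1) - m * a * (2 * (m * a) - 10) = 12 := by rw [h1]; ring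
        exact hk ▸ dvd_sub hd (Dvd.intro _ rfl)
      have := Int.le_of_dvd (by norm_num) h12
      omega

end SmallDegree

end IsRankOneQuadratic
end SimpleGraph

namespace SimpleGraph

variable {V : Type*} [Fintype V] [DecidableEq V] {G : SimpleGraph V} [DecidableRel G.Adj]

theorem Connected.eq_zero_of_adjMatrix_mulVec (hG : G.Connected) {s : ℝ}
    (hps : (s • (1 : Matrix V V ℝ) - G.adjMatrix ℝ).PosSemidef) {x : V → ℝ}
    (hx : G.adjMatrix ℝ *ᵥ x = s • x) {v : V} (hv : x v = 0) : x = 0 := by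
  have hdot : ∀ y : V → ℝ, y ⬝ᵥ ((s • (1 : Matrix V V ℝ) - G.adjMatrix ℝ) *ᵥ y)
      = s * ∑ u, y u * y u - ∑ u, ∑ w ∈ G.neighborFinset u, y u * y w := by
    intro y
    simp [dotProduct, Matrix.sub_mulVec, Matrix.smul_mulVec, mul_sub, mul_sum]
    exact sum_congr rfl fun _ _ => by ring
  have habs : G.adjMatrix ℝ *ᵥ |x| = s • |x| := by
    have h0 : |x| ⬝ᵥ ((s • (1 : Matrix V V ℝ) - G.adjMatrix ℝ) *ᵥ |x|) ≤ 0 := by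
      have h1 : x ⬝ᵥ ((s • (1 : Matrix V V ℝ) - G.adjMatrix ℝ) *ᵥ x) = 0 := by
        simp [Matrix.sub_mulVec, Matrix.smul_mulVec, hx]
      rw [← h1, hdot, hdot]
      simp only [Pi.abs_apply, abs_mul_abs_self]
      refine sub_le_sub_left (sum_le_sum fun u _ => sum_le_sum fun w _ => ?_) _
      rw [← abs_mul]
      exact le_abs_self _
    have h2 := le_antisymm h0 (by simpa using hps.dotProduct_mulVec_nonneg |x|)
    have h3 := (hps.dotProduct_mulVec_zero_iff |x|).1 (by simpa using h2)
    rw [Matrix.sub_mulVec, sub_eq_zero] at h3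
    simpa [Matrix.smul_mulVec] using h3.symm
  have hstep : ∀ u w, G.Adj u w → x u = 0 → x w = 0 := by
    intro u w huw hu
    have := congrFun habs u
    simp only [adjMatrix_mulVec_apply, Pi.abs_apply, Pi.smul_apply, hu, abs_zero, smul_zero] at this
    rw [sum_eq_zero_iff_of_nonneg fun _ _ => abs_nonneg _] at this
    exact abs_eq_zero.1 (this w ((G.mem_neighborFinset u w).2 huw))
  funext w
  obtain ⟨p⟩ := hG v w
  induction p with
  | nil => exact hv
  | cons h _ ih => exact ih (hstep _ _ h hv)

/-- If `A` has an eigenvalue `s` exceeding its only other eigenvalues `1` and `-t`, then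
`(A - 1) (A + t)` is entrywise a rank one matrix with nonzero diagonal. -/
theorem Connected.mul_apply_eq_of_spectrum (hG : G.Connected) {s t : ℝ} (hs : 1 < s) (ht : -t < 1)
    (hspec : spectrum ℝ (G.adjMatrix ℝ) = {s, 1, -t}) {P : Matrix V V ℝ}
    (hP : P = G.adjMatrix ℝ * G.adjMatrix ℝ + (t - 1) • G.adjMatrix ℝ - t • 1) :
    (∀ j, 0 < P j j) ∧ ∀ i j k, P j j * P k i = P j i * P k j := by
  set A := G.adjMatrix ℝ with hAdef
  have hA : A.IsHermitian := by
    rw [Matrix.IsHermitian, Matrix.conjTranspose_eq_transpose_of_trivial, transpose_adjMatrix]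
  have hps : (s • (1 : Matrix V V ℝ) - A).PosSemidef := by
    refine hA.posSemidef_smul_one_sub fun x hx => ?_
    rw [hspec] at hx
    rcases hx with rfl | rfl | rfl
    exacts [le_rfl, hs.le, by linarith]
  have hAP : A * P = s • P := by
    have h0 := hA.aeval_eq_zero_of_spectrum
      ((Polynomial.X - Polynomial.C s) * (Polynomial.X - Polynomial.C 1) *
        (Polynomial.X + Polynomial.C t)) fun x hx => by
          rw [hspec] at hx
          rcases hx with rfl | rfl | rfl <;> simp
    simp only [map_mul, map_sub, map_add, Polynomial.aeval_X, Polynomial.aeval_C,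
      Algebra.algebraMap_eq_smul_one] at h0
    rw [← sub_eq_zero, ← h0, hP]
    simp only [mul_sub, sub_mul, mul_add, smul_mul_assoc, mul_smul_comm, one_mul, mul_one,
      smul_sub, smul_add, mul_assoc]
    module
  have hsymm : ∀ i j, P i j = P j i := by
    have : Pᵀ = P := by
      rw [hP]
      simp [Matrix.transpose_mul, hAdef]
    intro i j
    conv_lhs => rw [← this]
    rfl
  have hcol : ∀ i, A *ᵥ P.col i = s • P.col i := by
    intro i
    ext k
    exact congrFun (congrFun hAP k) i
  have hne : P ≠ 0 := by
    intro h0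
    have hsA : s ∈ spectrum ℝ A := by simp [hspec]
    rw [← Matrix.spectrum_toLin', ← Module.End.hasEigenvalue_iff_mem_spectrum] at hsA
    obtain ⟨x, hx⟩ := hsA.exists_hasEigenvector
    have hxs : A *ᵥ x = s • x := by simpa using hx.apply_eq_smul
    have hPx : P *ᵥ x = ((s - 1) * (s + t)) • x := by
      rw [hP, Matrix.sub_mulVec, Matrix.add_mulVec, ← Matrix.mulVec_mulVec, Matrix.smul_mulVec,
        Matrix.smul_mulVec, hxs, Matrix.mulVec_smul, hxs, Matrix.one_mulVec]
      module
    rw [h0, Matrix.zero_mulVec, eq_comm, smul_eq_zero] at hPx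
    rcases hPx with h | h
    · have : 0 < (s - 1) * (s + t) := mul_pos (by linarith) (by linarith)
      exact this.ne' h
    · exact hx.2 h
  have hdiag : ∀ j, P j j ≠ 0 := by
    intro j hj
    have h1 : P.col j = 0 := hG.eq_zero_of_adjMatrix_mulVec hps (hcol j) hj
    refine hne (Matrix.ext fun k i => ?_)
    have h2 : P.col i = 0 := hG.eq_zero_of_adjMatrix_mulVec hps (hcol i) (v := j) <| by
      rw [Matrix.col_apply, hsymm]
      exact congrFun h1 i
    exact congrFun h2 k
  have hrank : ∀ i j k, P j j * P k i = P j i * P k j := by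
    intro i j k
    have h1 : A *ᵥ (P j j • P.col i - P j i • P.col j)
        = s • (P j j • P.col i - P j i • P.col j) := by
      rw [Matrix.mulVec_sub, Matrix.mulVec_smul, Matrix.mulVec_smul, hcol, hcol]
      module
    have h2 := hG.eq_zero_of_adjMatrix_mulVec hps h1 (v := j) (by simp [mul_comm])
    have := congrFun h2 k
    simpa [sub_eq_zero] using this
  have hPP : P * P = ((s - 1) * (s + t)) • P := by
    nth_rewrite 1 [hP]
    rw [sub_mul, add_mul, mul_assoc, smul_mul_assoc, smul_mul_assoc, hAP, mul_smul_comm, hAP,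
      one_mul]
    module
  refine ⟨fun j => (hdiag j).symm.lt_of_le ?_, hrank⟩
  have h1 := congrFun (congrFun hPP j) j
  rw [Matrix.mul_apply, Matrix.smul_apply, smul_eq_mul] at h1
  have h2 : 0 ≤ ∑ k, P j k * P k j := sum_nonneg fun k _ => by
    rw [hsymm k j]
    exact mul_self_nonneg _
  rw [h1] at h2
  exact nonneg_of_mul_nonneg_right h2 (mul_pos (by linarith) (by linarith))

theorem adjMatrix_quadratic_apply (G : SimpleGraph V) [DecidableRel G.Adj] (t : ℝ) (u w : V) :
    (G.adjMatrix ℝ * G.adjMatrix ℝ + (t - 1) • G.adjMatrix ℝ - t • 1) u w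
      = #(G.neighborFinset u ∩ G.neighborFinset w) + (t - 1) * (if G.Adj u w then 1 else 0)
        - (if u = w then t else 0) := by
  have h : (G.adjMatrix ℝ * G.adjMatrix ℝ) u w = #(G.neighborFinset u ∩ G.neighborFinset w) := by
    rw [adjMatrix_mul_apply, ← filter_mem_eq_inter]
    simp [adj_comm]
  rw [Matrix.sub_apply, Matrix.add_apply, h]
  simp [Matrix.one_apply]

theorem Connected.exists_isRankOneQuadratic (hG : G.Connected) {s t : ℝ} (hs : 1 < s)
    (ht : 1 < t) (hspec : spectrum ℝ (G.adjMatrix ℝ) = {s, 1, -t}) {v : V}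
    (hv : (G.degree v : ℝ) < t + 3) :
    ∃ (k m : ℤ) (z : V → ℤ), t = k ∧ (m = 1 ∨ m = 2) ∧ (∀ u, 0 < z u) ∧ z v = 1 ∧
      G.IsRankOneQuadratic k m z := by
  obtain ⟨P, hP⟩ : ∃ P, P = G.adjMatrix ℝ * G.adjMatrix ℝ + (t - 1) • G.adjMatrix ℝ - t • 1 :=
    ⟨_, rfl⟩
  obtain ⟨hpos, hrank⟩ := hG.mul_apply_eq_of_spectrum hs (by linarith) hspec hP
  have hent : ∀ u w, P u w = #(G.neighborFinset u ∩ G.neighborFinset w)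
      + (t - 1) * (if G.Adj u w then 1 else 0) - (if u = w then t else 0) := by
    intro u w
    rw [hP, adjMatrix_quadratic_apply]
  have hdeg : ∀ u, P u u = G.degree u - t := by
    intro u
    simp [hent]
  have hsymm : ∀ u w, P u w = P w u := by
    intro u w
    rw [hent, hent, inter_comm]
    simp only [adj_comm, eq_comm]
  have hnn : ∀ u w, 0 ≤ P u w := by
    intro u w
    rcases eq_or_ne u w with rfl | hne
    · exact (hpos u).le
    · rw [hent, if_neg hne]
      have : (0 : ℝ) ≤ (t - 1) * (if G.Adj u w then 1 else 0) :=
        mul_nonneg (by linarith) (by split_ifs <;> simp)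
      simp only [sub_zero]
      positivity
  have hppos : ∀ u w, 0 < P u w := by
    intro u w
    refine (hnn u w).lt_of_ne' fun h0 => ?_
    have h1 := hrank u w u
    rw [h0, mul_zero] at h1
    exact (mul_pos (hpos w) (hpos u)).ne' h1
  obtain ⟨k, rfl⟩ : ∃ k : ℤ, t = k := by
    have hint : IsIntegral ℤ t := by
      have : IsIntegral ℤ (-t) := by
        refine (G.adjMatrix ℤ).isIntegral_of_mem_spectrum_map ?_
        have hmap : (G.adjMatrix ℤ).map (Int.cast : ℤ → ℝ) = G.adjMatrix ℝ := by
          ext; simp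
        rw [hmap, hspec]
        simp
      simpa using this.neg
    have hdv : 0 < G.degree v := by
      have := hpos v
      rw [hdeg] at this
      have : (0 : ℝ) < G.degree v := by linarith
      exact_mod_cast this
    obtain ⟨w, hw⟩ := (G.degree_pos_iff_exists_adj v).1 hdv
    have h1 := hrank w v w
    have h2 : P v w = #(G.neighborFinset v ∩ G.neighborFinset w) + (t - 1) := by
      simp [hent, hw, hw.ne]
    rw [hsymm w v, h2, hdeg, hdeg] at h1
    set c := #(G.neighborFinset v ∩ G.neighborFinset w)
    have hdv1 := hpos v
    have hdw1 := hpos w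
    rw [hdeg] at hdv1 hdw1
    have hdv2 : 1 < G.degree v := by
      have : (1 : ℝ) < G.degree v := by linarith
      exact_mod_cast this
    have hdw2 : 1 < G.degree w := by
      have : (1 : ℝ) < G.degree w := by linarith
      exact_mod_cast this
    refine exists_int_eq_of_isIntegral hint
      (a := G.degree v + G.degree w + 2 * (c - 1)) (b := G.degree v * G.degree w - (c - 1) ^ 2)
      (by omega) ?_
    push_cast
    linear_combination -h1
  obtain ⟨Q, hQ⟩ : ∃ Q : V → V → ℤ, ∀ u w, Q u w = #(G.neighborFinset u ∩ G.neighborFinset w)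
      + (k - 1) * (if G.Adj u w then 1 else 0) - (if u = w then k else 0) := ⟨_, fun _ _ => rfl⟩
  have hPQ : ∀ u w, P u w = Q u w := by
    intro u w
    rw [hent, hQ]
    push_cast
    rfl
  simp only [hPQ] at hrank hppos hsymm hdeg
  norm_cast at hrank
  have hQpos : ∀ u w, 0 < Q u w := fun u w => by exact_mod_cast hppos u w
  have hQsymm : ∀ u w, Q u w = Q w u := fun u w => by exact_mod_cast hsymm u w
  have hm : Q v v = 1 ∨ Q v v = 2 := by
    have h1 := hQpos v v
    have h2 : Q v v < 3 := by
      have : (Q v v : ℝ) < 3 := by rw [hdeg]; linarith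
      exact_mod_cast this
    omega
  have hz : ∀ u, ∃ z, Q v u = Q v v * z := by
    intro u
    rcases hm with h | h
    · exact ⟨Q v u, by rw [h, one_mul]⟩
    · have h1 := hrank u v u
      rw [hQsymm u v, h] at h1
      rw [h]
      exact Int.prime_two.dvd_or_dvd ⟨_, h1.symm⟩ |>.elim id id
  choose z hz using hz
  refine ⟨k, Q v v, z, rfl, hm, fun u => ?_, ?_, fun u w => ?_⟩
  · have := hQpos v u
    rw [hz] at this
    exact pos_of_mul_pos_right this (hQpos v v).le
  · have := hz v
    exact (mul_eq_left₀ (hQpos v v).ne').1 this.symm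
  · rw [← hQ]
    have h1 := hrank w v u
    rw [hQsymm u v, hz u, hz w] at h1
    apply mul_left_cancel₀ (hQpos v v).ne'
    linear_combination h1

end SimpleGraph

end AuxiliaryResults

/-- A graph in H′(s,t) with t ≥ 11 has minimum degree δ(Γ) ≥ t + 3. -/
theorem H'_st_min_degree_ge_t_add_three
    {V : Type} [Fintype V] [DecidableEq V] (Γ : SimpleGraph V) [DecidableRel Γ.Adj]
    (s t : ℝ)
    (hconn : Γ.Connected)
    (hnonreg : ¬ ∃ k, Γ.IsRegularOfDegree k)
    (hs : 1 < s) (ht : -t < 1)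
    (hspec : spectrum ℝ (Γ.adjMatrix ℝ) = {s, 1, -t})
    (hnotcone : ¬ ∃ v : V, Γ.degree v = Fintype.card V - 1)
    (hnotbireg : ((Finset.univ : Finset V).image (fun v => Γ.degree v)).card ≠ 2)
    (ht11 : 11 ≤ t) :
    (Γ.minDegree : ℝ) ≥ t + 3 := by
  by_contra! hlt
  have : Nonempty V := hconn.nonempty
  obtain ⟨v, hv⟩ := Γ.exists_minimal_degree_vertex
  rw [hv] at hlt
  obtain ⟨k, m, z, rfl, hm, hpos, hzv, h⟩ :=
    hconn.exists_isRankOneQuadratic hs (by linarith) hspec hlt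
  refine h.not_exists_not_adj hzv hm (by exact_mod_cast ht11) hpos ?_
  by_contra! hall
  refine hnotcone ⟨v, ?_⟩
  rw [← Γ.card_neighborFinset_eq_degree, ← Finset.card_univ,
    ← Finset.card_erase_of_mem (Finset.mem_univ v)]
  congr 1
  ext w
  simp only [SimpleGraph.mem_neighborFinset, Finset.mem_erase, Finset.mem_univ, and_true]
  exact ⟨fun hw => hw.ne', hall w⟩
end

section
/- Let Γ be an n-vertex connected nonregular finite simple graph whose adjacency matrix has exactly three distinct eigenvalues s > 1 > −t, which is not a cone and not biregular. Let x be a vertex with d_x = Δ(Γ), and suppose Γ has a vertex y with α_y ≤ α_x − 4, where α_v := √(d_v − t). Then t ≤ 29. -/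
open Finset Matrix

theorem Matrix.IsHermitian.sub_mul_sub_mul_sub_eq_zero {V : Type*} [Fintype V] [DecidableEq V]
    {A : Matrix V V ℝ} (hA : A.IsHermitian) {a b c : ℝ} (h : spectrum ℝ A ⊆ {a, b, c}) :
    (A - a • 1) * ((A - b • 1) * (A - c • 1)) = 0 := by
  have hsp := hA.spectral_theorem
  set φ := Unitary.conjStarAlgAut ℝ (Matrix V V ℝ) hA.eigenvectorUnitary
  set D : Matrix V V ℝ := diagonal (RCLike.ofReal ∘ hA.eigenvalues)
  have key : ∀ r : ℝ, A - r • 1 = φ (D - r • 1) := by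
    intro r
    rw [map_sub, map_smul, map_one, ← hsp]
  rw [key, key, key, ← map_mul, ← map_mul]
  have : (D - a • 1) * ((D - b • 1) * (D - c • 1)) = 0 := by
    have hd : ∀ r : ℝ, D - r • 1 = diagonal (fun i => hA.eigenvalues i - r) := by
      intro r
      ext i j
      by_cases hij : i = j
      · subst hij; simp [D]
      · simp [D, hij]
    rw [hd, hd, hd, diagonal_mul_diagonal, diagonal_mul_diagonal]
    ext i j
    by_cases hij : i = j
    · subst hij
      have := h (hA.eigenvalues_mem_spectrum_real i)
      simp only [Set.mem_insert_iff, Set.mem_singleton_iff] at this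
      rcases this with h | h | h <;> simp [h]
    · simp [hij]
  rw [this, map_zero]

/-- The data carried by a graph with adjacency eigenvalues `s`, `1`, `-t`: the matrix
`(A - 1) * (A + t)` is the rank one matrix with entries `α u * α v`. -/
structure SpectralData {V : Type*} [Fintype V] [DecidableEq V] (Γ : SimpleGraph V)
    [DecidableRel Γ.Adj] (s t : ℝ) (α : V → ℝ) : Prop where
  pos : ∀ v, 0 < α v
  sq : ∀ v, α v ^ 2 = Γ.degree v - t
  adj : ∀ u v, Γ.Adj u v → ((Γ.neighborFinset u ∩ Γ.neighborFinset v).card : ℝ) = α u * α v - t + 1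
  nonadj : ∀ u v, u ≠ v → ¬ Γ.Adj u v →
    ((Γ.neighborFinset u ∩ Γ.neighborFinset v).card : ℝ) = α u * α v
  eig : ∀ v, ∑ u ∈ Γ.neighborFinset v, α u = s * α v
  norm : ∑ v, α v ^ 2 = (s - 1) * (s + t)

theorem pos_of_nonneg_of_sum_neighbors {V : Type*} [Fintype V] [DecidableEq V] {Γ : SimpleGraph V}
    [DecidableRel Γ.Adj] (hconn : Γ.Connected) {s : ℝ} (p : V → ℝ) (h0 : ∀ v, 0 ≤ p v)
    (he : ∀ v, ∑ u ∈ Γ.neighborFinset v, p u = s * p v) (w : V) (hw : p w = 0) :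
    ∀ v, p v = 0 := by
  intro v
  obtain ⟨q⟩ := hconn.preconnected w v
  induction q with
  | nil => exact hw
  | @cons a b c hadj q ih =>
    apply ih
    have := he a
    rw [hw, mul_zero, Finset.sum_eq_zero_iff_of_nonneg (fun i _ => h0 i)] at this
    exact this _ (by simpa using hadj)

theorem mul_adjMatrix_sq_apply {V : Type*} [Fintype V] [DecidableEq V] (Γ : SimpleGraph V)
    [DecidableRel Γ.Adj] (u v : V) :
    (Γ.adjMatrix ℝ * Γ.adjMatrix ℝ) u v =
      ((Γ.neighborFinset u ∩ Γ.neighborFinset v).card : ℝ) := by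
  rw [SimpleGraph.adjMatrix_mul_apply]
  simp only [SimpleGraph.adjMatrix_apply, Finset.sum_boole]
  congr 2
  ext w
  simp [SimpleGraph.adj_comm]

theorem exists_spectralData {V : Type*} [Fintype V] [DecidableEq V] (Γ : SimpleGraph V)
    [DecidableRel Γ.Adj] {s t : ℝ} (hconn : Γ.Connected) (hs : 1 < s) (ht : 1 ≤ t)
    (hspec : spectrum ℝ (Γ.adjMatrix ℝ) = {s, 1, -t}) :
    ∃ α : V → ℝ, SpectralData Γ s t α := by
  set A := Γ.adjMatrix ℝ with hAdef
  have hAT : Aᵀ = A := Γ.transpose_adjMatrix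
  have hH : A.IsHermitian := by
    rw [IsHermitian, conjTranspose_eq_transpose_of_trivial, hAT]
  have hcub := hH.sub_mul_sub_mul_sub_eq_zero hspec.le
  set M := (A - (1 : ℝ) • 1) * (A - (-t) • 1) with hM
  have hMexp : M = A * A + (t - 1) • A - t • 1 := by
    rw [hM]
    simp only [sub_mul, mul_sub, smul_mul_assoc, mul_smul_comm, one_mul, mul_one]
    module
  have hAM : A * M = s • M := by
    have := hcub
    rw [sub_mul, smul_mul_assoc, one_mul, sub_eq_zero] at this
    exact this
  have hMT : Mᵀ = M := by
    rw [hMexp]; simp [hAT]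
  have hMs : ∀ u v, M u v = M v u := fun u v => congrFun (congrFun hMT v) u
  have hMuv : ∀ u v, M u v = ((Γ.neighborFinset u ∩ Γ.neighborFinset v).card : ℝ)
      + (t - 1) * A u v - t * (1 : Matrix V V ℝ) u v := by
    intro u v
    rw [hMexp, ← mul_adjMatrix_sq_apply]
    simp [hAdef]
  have hc : 0 < (s - 1) * (s + t) := by
    apply mul_pos <;> linarith
  have hMM : M * M = ((s - 1) * (s + t)) • M := by
    nth_rw 1 [hMexp]
    rw [sub_mul, add_mul, mul_assoc, smul_mul_assoc, smul_mul_assoc, one_mul, hAM, mul_smul_comm,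
      hAM, smul_smul, smul_smul]
    rw [← add_smul, ← sub_smul]
    congr 1
    ring
  have hMM' : ∀ u v, ∑ w, M u w * M w v = (s - 1) * (s + t) * M u v := by
    intro u v
    rw [← Matrix.mul_apply, hMM]; simp
  have hdiag : ∀ v, 0 ≤ M v v := by
    intro v
    have h1 := hMM' v v
    have h2 : 0 ≤ ∑ w, M v w * M w v := Finset.sum_nonneg fun w _ => by
      rw [hMs w v]; exact mul_self_nonneg _
    rw [h1] at h2
    exact nonneg_of_mul_nonneg_right h2 hc
  have hnn : ∀ u v, 0 ≤ M u v := by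
    intro u v
    by_cases huv : u = v
    · subst huv; exact hdiag u
    · rw [hMuv, Matrix.one_apply_ne huv, hAdef, SimpleGraph.adjMatrix_apply]
      have : (0 : ℝ) ≤ ((Γ.neighborFinset u ∩ Γ.neighborFinset v).card : ℝ) := by positivity
      split_ifs <;> linarith
  have heig : ∀ v w, ∑ u ∈ Γ.neighborFinset v, M u w = s * M v w := by
    intro v w
    rw [← SimpleGraph.adjMatrix_mul_apply, ← hAdef, hAM]; simp
  have hzero : ∀ u w, M u w = 0 → ∀ v, M v w = 0 := fun u w h =>
    pos_of_nonneg_of_sum_neighbors hconn (fun v => M v w) (fun v => hnn v w) (fun v => heig v w) u h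
  have hMne : M ≠ 0 := by
    intro h0
    have hs' : s ∈ spectrum ℝ A := by rw [hspec]; simp
    rw [← Matrix.spectrum_toLin', ← Module.End.hasEigenvalue_iff_mem_spectrum] at hs'
    obtain ⟨p, hp⟩ := hs'.exists_hasEigenvector
    have hp1 : A *ᵥ p = s • p := by simpa using hp.apply_eq_smul
    have : M *ᵥ p = ((s - 1) * (s + t)) • p := by
      rw [hMexp, sub_mulVec, add_mulVec, ← mulVec_mulVec, smul_mulVec, smul_mulVec, one_mulVec,
        hp1, mulVec_smul, hp1, smul_smul, smul_smul, ← add_smul, ← sub_smul]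
      congr 1; ring
    rw [h0, zero_mulVec] at this
    have := smul_eq_zero.mp this.symm
    rcases this with h | h
    · exact hc.ne' h
    · exact hp.2 h
  have hpos : ∀ u v, 0 < M u v := by
    by_contra! hcon
    obtain ⟨u, v, huv⟩ := hcon
    have huv : M u v = 0 := le_antisymm huv (hnn u v)
    apply hMne
    have h1 : ∀ w, M w v = 0 := hzero u v huv
    ext a b
    apply hzero v b
    rw [hMs]; exact h1 b
  have hprop : ∀ u v w, M w u * M v v = M v u * M w v := by
    intro u v w
    have : Nonempty V := ⟨v⟩
    obtain ⟨z, -, hz⟩ := Finset.exists_min_image Finset.univ (fun z => M z u / M z v)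
      Finset.univ_nonempty
    set c := M z u / M z v with hcdef
    have hq := pos_of_nonneg_of_sum_neighbors hconn (s := s) (fun y => M y u - c * M y v)
      (fun y => by
        have := hz y (Finset.mem_univ y)
        rw [le_div_iff₀ (hpos y v)] at this
        linarith)
      (fun y => by
        rw [Finset.sum_sub_distrib, ← Finset.mul_sum, heig, heig]; ring) z
      (by
        have := (hpos z v).ne'
        rw [hcdef]; field_simp; ring)
    have h1 := hq w
    have h2 := hq v
    simp only [sub_eq_zero] at h1 h2
    rw [h1, h2]; ring
  set α : V → ℝ := fun v => Real.sqrt (M v v) with hα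
  have hαpos : ∀ v, 0 < α v := fun v => Real.sqrt_pos.mpr (hpos v v)
  have hα2 : ∀ v, α v ^ 2 = M v v := fun v => Real.sq_sqrt (hdiag v)
  have hαM : ∀ u v, α u * α v = M u v := by
    intro u v
    rw [hα, ← Real.sqrt_mul (hdiag u)]
    rw [hprop u v u, hMs v u, Real.sqrt_mul_self (hnn u v)]
  refine ⟨α, hαpos, ?_, ?_, ?_, ?_, ?_⟩
  · intro v
    rw [hα2, hMuv, hAdef]
    simp
  · intro u v h
    rw [hαM, hMuv, hAdef]
    simp [h, Γ.ne_of_adj h]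
    ring
  · intro u v h1 h2
    rw [hαM, hMuv, hAdef]
    simp [h1, h2]
  · intro v
    have := heig v v
    simp only [← hαM, ← Finset.sum_mul] at this
    apply mul_right_cancel₀ (hαpos v).ne'
    rw [this]; ring
  · obtain ⟨v⟩ := hconn.nonempty
    have := hMM' v v
    have h2 : ∑ w, M v w * M w v = α v ^ 2 * ∑ w, α w ^ 2 := by
      rw [Finset.mul_sum]
      refine Finset.sum_congr rfl fun w _ => ?_
      rw [← hαM, ← hαM]; ring
    rw [h2, ← hα2] at this
    have hne : α v ^ 2 ≠ 0 := pow_ne_zero _ (hαpos v).ne'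
    apply mul_left_cancel₀ hne
    rw [this]; ring

namespace SpectralData

variable {V : Type*} [Fintype V] [DecidableEq V] {Γ : SimpleGraph V} [DecidableRel Γ.Adj]
  {s t : ℝ} {α : V → ℝ}

/-- A multiple of the orthogonal projection onto the `-t` eigenspace. -/
noncomputable def projMatrix (Γ : SimpleGraph V) [DecidableRel Γ.Adj] (s t : ℝ) (α : V → ℝ) :
    Matrix V V ℝ :=
  1 - Γ.adjMatrix ℝ + (s + t)⁻¹ • vecMulVec α α

theorem adjMatrix_mulVec (h : SpectralData Γ s t α) : Γ.adjMatrix ℝ *ᵥ α = s • α := by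
  ext v
  rw [SimpleGraph.adjMatrix_mulVec_apply, h.eig]; simp

theorem adjMatrix_mul_self (h : SpectralData Γ s t α) :
    Γ.adjMatrix ℝ * Γ.adjMatrix ℝ =
      vecMulVec α α - (t - 1) • Γ.adjMatrix ℝ + t • (1 : Matrix V V ℝ) := by
  ext u v
  rw [mul_adjMatrix_sq_apply]
  by_cases huv : u = v
  · subst huv
    have := h.sq u
    simp [vecMulVec_apply]
    linarith
  · by_cases hadj : Γ.Adj u v
    · rw [h.adj u v hadj]
      simp [vecMulVec_apply, hadj, huv]
      ring
    · rw [h.nonadj u v huv hadj]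
      simp [vecMulVec_apply, hadj, huv]

theorem projMatrix_mul_self (h : SpectralData Γ s t α) (hst : s + t ≠ 0) :
    projMatrix Γ s t α * projMatrix Γ s t α = (1 + t) • projMatrix Γ s t α := by
  have h1 : Γ.adjMatrix ℝ * vecMulVec α α = s • vecMulVec α α := by
    rw [mul_vecMulVec, h.adjMatrix_mulVec, smul_vecMulVec]
  have h2 : vecMulVec α α * Γ.adjMatrix ℝ = s • vecMulVec α α := by
    have := congrArg Matrix.transpose h1
    rwa [transpose_mul, SimpleGraph.transpose_adjMatrix, transpose_smul, transpose_vecMulVec]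
      at this
  have h3 : vecMulVec α α * vecMulVec α α = ((s - 1) * (s + t)) • vecMulVec α α := by
    rw [vecMulVec_mul_vecMulVec, ← h.norm]
    ext u v
    simp [vecMulVec_apply, dotProduct, Finset.sum_mul, Finset.mul_sum]
    refine Finset.sum_congr rfl fun w _ => by ring
  have h4 := h.adjMatrix_mul_self
  rw [projMatrix]
  simp only [mul_add, add_mul, mul_sub, sub_mul, mul_one, one_mul, smul_mul_assoc, mul_smul_comm,
    h1, h2, h3, h4]
  ext u v
  simp only [Matrix.add_apply, Matrix.sub_apply, Matrix.smul_apply, smul_eq_mul]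
  field_simp
  ring

theorem trace_projMatrix (h : SpectralData Γ s t α) (hst : s + t ≠ 0) :
    (projMatrix Γ s t α).trace = Fintype.card V + s - 1 := by
  have : (vecMulVec α α).trace = (s - 1) * (s + t) := by
    rw [← h.norm]
    simp [Matrix.trace, vecMulVec_apply, ← pow_two]
  rw [projMatrix, trace_add, trace_sub, trace_smul, this, trace_one, SimpleGraph.trace_adjMatrix,
    smul_eq_mul]
  field_simp
  ring

theorem transpose_projMatrix : (projMatrix Γ s t α)ᵀ = projMatrix Γ s t α := by
  rw [projMatrix, transpose_add, transpose_sub, transpose_smul, transpose_vecMulVec,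
    SimpleGraph.transpose_adjMatrix, transpose_one]

theorem dotProduct_projMatrix_nonneg (h : SpectralData Γ s t α) (hst : s + t ≠ 0) (ht : 0 < 1 + t)
    (c : V → ℝ) : 0 ≤ c ⬝ᵥ (projMatrix Γ s t α *ᵥ c) := by
  have h1 : (1 + t) * (c ⬝ᵥ (projMatrix Γ s t α *ᵥ c)) =
      (projMatrix Γ s t α *ᵥ c) ⬝ᵥ (projMatrix Γ s t α *ᵥ c) := by
    rw [dotProduct_mulVec (projMatrix Γ s t α *ᵥ c), ← mulVec_transpose, transpose_projMatrix,
      mulVec_mulVec, h.projMatrix_mul_self hst, smul_mulVec, smul_dotProduct, smul_eq_mul,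
      dotProduct_comm c]
  have h2 : 0 ≤ (projMatrix Γ s t α *ᵥ c) ⬝ᵥ (projMatrix Γ s t α *ᵥ c) :=
    Finset.sum_nonneg fun i _ => mul_self_nonneg _
  rw [← h1] at h2
  exact nonneg_of_mul_nonneg_right h2 ht

theorem dotProduct_projMatrix (c : V → ℝ) :
    c ⬝ᵥ (projMatrix Γ s t α *ᵥ c) =
      ∑ v, c v ^ 2 - ∑ v, ∑ u, (if Γ.Adj v u then c v * c u else 0) +
        (s + t)⁻¹ * (∑ v, α v * c v) ^ 2 := by
  rw [projMatrix, add_mulVec, sub_mulVec, one_mulVec, smul_mulVec, vecMulVec_mulVec,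
    dotProduct_add, dotProduct_sub, dotProduct_smul]
  congr 1
  · congr 1
    · simp [dotProduct, ← pow_two]
    · simp [dotProduct, mulVec, Finset.mul_sum, SimpleGraph.adjMatrix_apply]
  · simp only [dotProduct, smul_eq_mul, pow_two, Pi.smul_apply, MulOpposite.smul_eq_mul_unop,
      MulOpposite.unop_op]
    congr 1
    rw [Finset.sum_mul]
    refine Finset.sum_congr rfl fun w _ => by ring

theorem card_le_trace_of_idempotent {E : Matrix V V ℝ} (hE : E * E = E) (S : Finset V)
    (hS : ∀ c : V → ℝ, (∀ v ∉ S, c v = 0) → E *ᵥ c = 0 → c = 0) : (S.card : ℝ) ≤ E.trace := by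
  have hid : IsIdempotentElem (Matrix.toLin' E) := by
    change Matrix.toLin' E ∘ₗ Matrix.toLin' E = _
    rw [← Matrix.toLin'_mul, hE]
  have htr : E.trace = Module.finrank ℝ (LinearMap.range (Matrix.toLin' E)) := by
    rw [← Matrix.trace_toLin'_eq, (LinearMap.IsIdempotentElem.isProj_range _ hid).trace]
  rw [htr]
  let L : (S → ℝ) →ₗ[ℝ] (V → ℝ) :=
    { toFun := fun c v => if h : v ∈ S then c ⟨v, h⟩ else 0
      map_add' := fun c d => by ext v; by_cases h : v ∈ S <;> simp [h]
      map_smul' := fun r c => by ext v; by_cases h : v ∈ S <;> simp [h] }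
  have hinj : Function.Injective ((Matrix.toLin' E).rangeRestrict ∘ₗ L) := by
    rw [← LinearMap.ker_eq_bot, LinearMap.ker_eq_bot']
    intro c hc
    have h1 : E *ᵥ L c = 0 := by
      have := congrArg Subtype.val hc
      simpa using this
    have h2 := hS (L c) (fun v hv => by simp [L, hv]) h1
    ext ⟨v, hv⟩
    have := congrFun h2 v
    simpa [L, hv] using this
  have := LinearMap.finrank_le_finrank_of_injective hinj
  rw [Module.finrank_fintype_fun_eq_card, Fintype.card_coe] at this
  exact_mod_cast this

theorem card_compl_union_neighborFinset (h : SpectralData Γ s t α) {u w : V} (huw : Γ.Adj u w) :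
    (((Γ.neighborFinset u ∪ Γ.neighborFinset w)ᶜ : Finset V).card : ℝ) =
      Fintype.card V - 3 * t + 1 - (α u ^ 2 + α w ^ 2 - α u * α w) := by
  have h1 := Finset.card_union_add_card_inter (Γ.neighborFinset u) (Γ.neighborFinset w)
  have h2 := Finset.card_add_card_compl (Γ.neighborFinset u ∪ Γ.neighborFinset w)
  have h3 := h.adj u w huw
  have h4 := h.sq u
  have h5 := h.sq w
  simp only [SimpleGraph.card_neighborFinset_eq_degree] at h1
  have h1' : (((Γ.neighborFinset u ∪ Γ.neighborFinset w).card : ℝ)) +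
      ((Γ.neighborFinset u ∩ Γ.neighborFinset w).card : ℝ) = Γ.degree u + Γ.degree w := by
    exact_mod_cast h1
  have h2' : (((Γ.neighborFinset u ∪ Γ.neighborFinset w).card : ℝ)) +
      (((Γ.neighborFinset u ∪ Γ.neighborFinset w)ᶜ : Finset V).card : ℝ) = Fintype.card V := by
    exact_mod_cast h2
  linarith

theorem projMatrix_apply (i j : V) :
    projMatrix Γ s t α i j =
      (if i = j then 1 else 0) - (if Γ.Adj i j then 1 else 0) + (s + t)⁻¹ * (α i * α j) := by
  simp [projMatrix, Matrix.one_apply, vecMulVec_apply, SimpleGraph.adjMatrix_apply]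

theorem eq_of_adj_of_adj_compl_union (h : SpectralData Γ s t α) (hst : s + t ≠ 0) (ht : 0 < 1 + t)
    {u w z a b : V} (huw : Γ.Adj u w)
    (hz : z ∈ (Γ.neighborFinset u ∪ Γ.neighborFinset w)ᶜ)
    (ha : a ∈ (Γ.neighborFinset u ∪ Γ.neighborFinset w)ᶜ)
    (hb : b ∈ (Γ.neighborFinset u ∪ Γ.neighborFinset w)ᶜ)
    (hza : Γ.Adj z a) (hzb : Γ.Adj z b) : a = b := by
  by_contra hab
  simp only [Finset.mem_compl, Finset.mem_union, SimpleGraph.mem_neighborFinset, not_or]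
    at hz ha hb
  obtain ⟨k, hk⟩ : ∃ k : ℝ, k * (α u + α w) = α z + α a + α b := by
    refine ⟨(α z + α a + α b) / (α u + α w), ?_⟩
    have := h.pos u
    have := h.pos w
    field_simp
  have hne : ∀ {p q : V}, Γ.Adj p q → p ≠ q := fun h => Γ.ne_of_adj h
  have huz : u ≠ z := by rintro rfl; exact hz.2 huw.symm
  have hua : u ≠ a := by rintro rfl; exact ha.2 huw.symm
  have hub : u ≠ b := by rintro rfl; exact hb.2 huw.symm
  have hwz : w ≠ z := by rintro rfl; exact hz.1 huw
  have hwa : w ≠ a := by rintro rfl; exact ha.1 huw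
  have hwb : w ≠ b := by rintro rfl; exact hb.1 huw
  have hzu' : ¬ Γ.Adj z u := fun h => hz.1 h.symm
  have hzw' : ¬ Γ.Adj z w := fun h => hz.2 h.symm
  have hau' : ¬ Γ.Adj a u := fun h => ha.1 h.symm
  have haw' : ¬ Γ.Adj a w := fun h => ha.2 h.symm
  have hbu' : ¬ Γ.Adj b u := fun h => hb.1 h.symm
  have hbw' : ¬ Γ.Adj b w := fun h => hb.2 h.symm
  have key := h.dotProduct_projMatrix_nonneg hst ht
    (k • (Pi.single u 1 + Pi.single w 1) - (Pi.single z 1 + Pi.single a 1 + Pi.single b 1))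
  simp only [mulVec_sub, mulVec_add, mulVec_smul, sub_dotProduct, add_dotProduct, smul_dotProduct,
    dotProduct_sub, dotProduct_add, dotProduct_smul, single_one_dotProduct, mulVec_single_one,
    Matrix.col_apply, projMatrix_apply, smul_eq_mul, huz, hua, hub, hwz, hwa, hwb, huz.symm,
    hua.symm, hub.symm, hwz.symm, hwa.symm, hwb.symm, hab, Ne.symm hab, hne hza, (hne hza).symm,
    hne hzb, (hne hzb).symm, hne huw, (hne huw).symm, huw, huw.symm, hza, hza.symm, hzb, hzb.symm,
    hz.1, hz.2, ha.1, ha.2, hb.1, hb.2, hzu', hzw', hau', haw', hbu', hbw', if_true, if_false,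
    SimpleGraph.irrefl] at key
  set X : ℝ := if Γ.Adj a b then 1 else 0 with hX
  set Y : ℝ := if Γ.Adj b a then 1 else 0 with hY
  have hX0 : 0 ≤ X := by rw [hX]; split_ifs <;> norm_num
  have hY0 : 0 ≤ Y := by rw [hY]; split_ifs <;> norm_num
  have h0 : (s + t)⁻¹ * (k * (α u + α w) - (α z + α a + α b)) ^ 2 = 0 := by
    rw [hk]; ring
  nlinarith [key, h0]

theorem card_add_two_le (h : SpectralData Γ s t α) (hst : 0 < s + t) (ht : 0 < 1 + t)
    {u w : V} (huw : Γ.Adj u w) {T : Finset V}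
    (hT : T ⊆ (Γ.neighborFinset u ∪ Γ.neighborFinset w)ᶜ)
    (hind : ∀ a ∈ T, ∀ b ∈ T, ¬ Γ.Adj a b) :
    ((T.card : ℝ) + 2) * (1 + t) ≤ Fintype.card V + s - 1 := by
  have hT' : ∀ z ∈ T, ¬ Γ.Adj u z ∧ ¬ Γ.Adj w z := by
    intro z hz
    simpa using hT hz
  have hu : u ∉ T := fun hu => (hT' u hu).2 huw.symm
  have hw : w ∉ T := fun hw => (hT' w hw).1 huw
  have huw' := Γ.ne_of_adj huw
  have hcard : (insert u (insert w T)).card = T.card + 2 := by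
    rw [Finset.card_insert_of_notMem, Finset.card_insert_of_notMem hw]
    simp [huw', hu]
  have hE : ((1 + t)⁻¹ • projMatrix Γ s t α) * ((1 + t)⁻¹ • projMatrix Γ s t α) =
      (1 + t)⁻¹ • projMatrix Γ s t α := by
    rw [smul_mul_assoc, mul_smul_comm, h.projMatrix_mul_self hst.ne', smul_smul (1 + t)⁻¹ (1 + t),
      inv_mul_cancel₀ ht.ne', one_smul]
  have key := card_le_trace_of_idempotent hE (insert u (insert w T)) (by
    intro c hc hc0
    rw [smul_mulVec, smul_eq_zero_iff_right (inv_ne_zero ht.ne')] at hc0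
    have hq := dotProduct_projMatrix (Γ := Γ) (s := s) (t := t) (α := α) c
    rw [hc0, dotProduct_zero] at hq
    have hsum : ∑ v, ∑ y, (if Γ.Adj v y then c v * c y else 0) = 2 * (c u * c w) := by
      have : ∀ v y, (if Γ.Adj v y then c v * c y else 0) =
          (if v = u then (if y = w then c u * c w else 0) else 0) +
          (if v = w then (if y = u then c u * c w else 0) else 0) := by
        intro v y
        have hcases : ∀ v, v = u ∨ v = w ∨ v ∈ T ∨ c v = 0 := by
          intro v
          by_cases hv : v ∈ insert u (insert w T)
          · simp only [Finset.mem_insert] at hv; tauto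
          · right; right; right; exact hc v hv
        rcases hcases v with rfl | rfl | hv | hv
        · rcases hcases y with rfl | rfl | hy | hy
          · simp [huw']
          · simp [huw, huw']
          · have := (hT' y hy).1
            have h2 : y ≠ w := by rintro rfl; exact hw hy
            simp [this, h2, huw']
          · by_cases h2 : y = w
            · subst h2; simp [hy, huw']
            · simp [hy, h2, huw']
        · rcases hcases y with rfl | rfl | hy | hy
          · simp [huw.symm, huw'.symm, mul_comm]
          · simp [huw'.symm]
          · have := (hT' y hy).2
            have h2 : y ≠ u := by rintro rfl; exact hu hy
            simp [this, h2, huw'.symm]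
          · by_cases h2 : y = u
            · subst h2; simp [hy, huw'.symm]
            · simp [hy, h2, huw'.symm]
        · have h1 : v ≠ u := by rintro rfl; exact hu hv
          have h2 : v ≠ w := by rintro rfl; exact hw hv
          simp only [h1, h2, if_false, add_zero]
          split_ifs with hadj
          · rcases hcases y with rfl | rfl | hy | hy
            · exact absurd hadj.symm (hT' v hv).1
            · exact absurd hadj.symm (hT' v hv).2
            · exact absurd hadj (hind v hv y hy)
            · rw [hy, mul_zero]
          · rfl
        · by_cases h1 : v = u
          · subst h1; simp [hv, huw']
          · by_cases h2 : v = w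
            · subst h2; simp [hv, h1]
            · simp [hv, h1, h2]
      simp only [this, Finset.sum_add_distrib]
      simp
      ring
    have hsq : ∑ v, c v ^ 2 = c u ^ 2 + c w ^ 2 +
        ∑ v ∈ (Finset.univ.erase u).erase w, c v ^ 2 := by
      rw [← Finset.add_sum_erase _ _ (Finset.mem_univ u),
        ← Finset.add_sum_erase _ _ (show w ∈ Finset.univ.erase u by simp [huw'.symm]), add_assoc]
    have hr : 0 ≤ ∑ v ∈ (Finset.univ.erase u).erase w, c v ^ 2 :=
      Finset.sum_nonneg fun i _ => sq_nonneg _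
    have hi : 0 < (s + t)⁻¹ := inv_pos.mpr hst
    have hα : 0 ≤ (s + t)⁻¹ * (∑ v, α v * c v) ^ 2 := mul_nonneg hi.le (sq_nonneg _)
    rw [hsum, hsq] at hq
    have e1 : (c u - c w) ^ 2 = 0 := by nlinarith [sq_nonneg (c u - c w)]
    have e2 : ∑ v ∈ (Finset.univ.erase u).erase w, c v ^ 2 = 0 := by
      nlinarith [sq_nonneg (c u - c w)]
    have e3 : (s + t)⁻¹ * (∑ v, α v * c v) ^ 2 = 0 := by nlinarith [sq_nonneg (c u - c w)]
    have e1' : c u = c w := by nlinarith [pow_eq_zero_iff (two_ne_zero) |>.mp e1]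
    have e2' : ∀ v, v ≠ u → v ≠ w → c v = 0 := by
      intro v h1 h2
      rw [Finset.sum_eq_zero_iff_of_nonneg (fun i _ => sq_nonneg _)] at e2
      exact pow_eq_zero_iff (two_ne_zero) |>.mp (e2 v (by simp [h1, h2]))
    have e3' : ∑ v, α v * c v = 0 := by
      rcases mul_eq_zero.mp e3 with h | h
      · exact absurd h hi.ne'
      · exact pow_eq_zero_iff (two_ne_zero) |>.mp h
    have e4 : ∑ v, α v * c v = (α u + α w) * c u := by
      rw [← Finset.add_sum_erase _ _ (Finset.mem_univ u),
        ← Finset.add_sum_erase _ _ (show w ∈ Finset.univ.erase u by simp [huw'.symm]),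
        Finset.sum_eq_zero, ← e1']
      · ring
      · intro v hv
        simp only [Finset.mem_erase] at hv
        rw [e2' v hv.2.1 hv.1, mul_zero]
    rw [e4] at e3'
    have hcu : c u = 0 := by
      rcases mul_eq_zero.mp e3' with h' | h'
      · have := h.pos u; have := h.pos w; linarith
      · exact h'
    ext v
    by_cases h1 : v = u
    · rw [h1, hcu]; rfl
    · by_cases h2 : v = w
      · rw [h2, ← e1', hcu]; rfl
      · exact e2' v h1 h2)
  rw [hcard, trace_smul, h.trace_projMatrix hst.ne', smul_eq_mul, inv_mul_eq_div,
    le_div_iff₀ ht] at key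
  push_cast at key
  exact key

theorem card_compl_union_le (h : SpectralData Γ s t α) (hst : 0 < s + t) (ht : 0 < 1 + t)
    {u w : V} (huw : Γ.Adj u w) :
    (((Γ.neighborFinset u ∪ Γ.neighborFinset w)ᶜ : Finset V).card : ℝ) ≤
      2 * (Fintype.card V + s - 1) / (1 + t) - 4 := by
  set C := (Γ.neighborFinset u ∪ Γ.neighborFinset w)ᶜ with hC
  obtain ⟨T, hTmem, hTmax⟩ := Finset.exists_max_image
    (C.powerset.filter fun T => ∀ a ∈ T, ∀ b ∈ T, ¬ Γ.Adj a b) Finset.card ⟨∅, by simp⟩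
  simp only [Finset.mem_filter, Finset.mem_powerset] at hTmem hTmax
  obtain ⟨hTC, hind⟩ := hTmem
  have hcard := h.card_add_two_le hst ht huw hTC hind
  have hdom : ∀ z ∈ C \ T, ∃ a ∈ T, Γ.Adj z a := by
    intro z hz
    rw [Finset.mem_sdiff] at hz
    by_contra! hcon
    have := hTmax (insert z T) ⟨by
      intro a ha
      rcases Finset.mem_insert.mp ha with rfl | ha
      · exact hz.1
      · exact hTC ha, by
      intro a ha b hb
      rcases Finset.mem_insert.mp ha with rfl | ha'
      · rcases Finset.mem_insert.mp hb with rfl | hb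
        · exact Γ.irrefl
        · exact hcon b hb
      · rcases Finset.mem_insert.mp hb with rfl | hb
        · exact fun h => hcon a ha' h.symm
        · exact hind a ha' b hb⟩
    rw [Finset.card_insert_of_notMem hz.2] at this
    omega
  have hle : (C \ T).card ≤ T.card := by
    choose! φ hφ hφ' using hdom
    refine Finset.card_le_card_of_injOn φ (fun z hz => hφ z hz) ?_
    intro z hz z' hz' heq
    have h1 := hφ' z hz
    have h2 := hφ' z' hz'
    rw [heq] at h1
    exact h.eq_of_adj_of_adj_compl_union hst.ne' ht huw (hTC (hφ z' hz'))
      (Finset.mem_sdiff.mp hz).1 (Finset.mem_sdiff.mp hz').1 h1.symm h2.symm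
  have hC2 : C.card ≤ 2 * T.card := by
    have := Finset.card_sdiff_add_card_eq_card hTC
    omega
  have hC2' : (C.card : ℝ) ≤ 2 * T.card := by exact_mod_cast hC2
  rw [le_sub_iff_add_le, le_div_iff₀ ht]
  nlinarith

theorem sum_mul_sum_neighborFinset {V : Type*} [Fintype V] {Γ : SimpleGraph V}
    [DecidableRel Γ.Adj] (f g : V → ℝ) :
    ∑ v, f v * ∑ u ∈ Γ.neighborFinset v, g u = ∑ v, g v * ∑ u ∈ Γ.neighborFinset v, f u := by
  have (f : V → ℝ) (v : V) :
      ∑ u ∈ Γ.neighborFinset v, f u = ∑ u, if Γ.Adj v u then f u else 0 := by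
    rw [← Finset.sum_filter]
    congr 1
    ext
    simp
  simp only [this, Finset.mul_sum]
  rw [Finset.sum_comm]
  refine Finset.sum_congr rfl fun u _ => Finset.sum_congr rfl fun v _ => ?_
  simp only [Γ.adj_comm u v]
  split_ifs <;> ring

theorem sum_pow_three (h : SpectralData Γ s t α) : ∑ v, α v ^ 3 = (s - t) * ∑ v, α v := by
  have h1 := sum_mul_sum_neighborFinset (Γ := Γ) α (fun _ => 1)
  simp only [h.eig, Finset.sum_const, SimpleGraph.card_neighborFinset_eq_degree, nsmul_eq_mul,
    mul_one, one_mul] at h1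
  rw [← Finset.mul_sum] at h1
  rw [sub_mul, ← h1, Finset.mul_sum, ← Finset.sum_sub_distrib]
  refine Finset.sum_congr rfl fun v _ => ?_
  have := h.sq v
  linear_combination α v * this

theorem card_inter_eq (h : SpectralData Γ s t α) (u v : V) :
    ((Γ.neighborFinset u ∩ Γ.neighborFinset v).card : ℝ) =
      α u * α v - (t - 1) * (if Γ.Adj u v then 1 else 0) + t * (if u = v then 1 else 0) := by
  by_cases huv : u = v
  · subst huv
    have := h.sq u
    simp only [Finset.inter_self, SimpleGraph.card_neighborFinset_eq_degree, SimpleGraph.irrefl,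
      if_false, if_true]
    linear_combination -this
  · by_cases hadj : Γ.Adj u v
    · simp only [h.adj u v hadj, hadj, huv, if_false, if_true]; ring
    · simp only [h.nonadj u v huv hadj, hadj, huv, if_false]; ring

theorem mul_sum (h : SpectralData Γ s t α) (v : V) :
    α v * ∑ u, α u =
      ∑ u ∈ Γ.neighborFinset v, α u ^ 2 + (2 * t - 1) * (α v ^ 2 + t) - t := by
  have h1 : ∑ u, ((Γ.neighborFinset u ∩ Γ.neighborFinset v).card : ℝ) =
      ∑ u ∈ Γ.neighborFinset v, (Γ.degree u : ℝ) := by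
    have := Finset.sum_card_bipartiteAbove_eq_sum_card_bipartiteBelow
      (s := (Finset.univ : Finset V)) (t := Γ.neighborFinset v) (r := fun u w => Γ.Adj u w)
    have e1 : ∀ u, Finset.bipartiteAbove (fun u w => Γ.Adj u w) (Γ.neighborFinset v) u =
        Γ.neighborFinset u ∩ Γ.neighborFinset v := by
      intro u; ext w; simp [Finset.mem_bipartiteAbove, and_comm]
    have e2 : ∀ w, (Finset.bipartiteBelow (fun u w => Γ.Adj u w) Finset.univ w).card =
        Γ.degree w := by
      intro w
      rw [← SimpleGraph.card_neighborFinset_eq_degree]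
      congr 1
      ext u; simp [Finset.mem_bipartiteBelow, Γ.adj_comm]
    simp only [e1, e2] at this
    exact_mod_cast this
  have h2 : ∀ u, (Γ.degree u : ℝ) = α u ^ 2 + t := fun u => by rw [h.sq]; ring
  simp only [h.card_inter_eq, h2, Finset.sum_add_distrib, Finset.sum_sub_distrib,
    ← Finset.mul_sum, ← Finset.sum_mul, Finset.sum_const, nsmul_eq_mul,
    SimpleGraph.card_neighborFinset_eq_degree] at h1
  have h3 : ∑ u, (if Γ.Adj u v then (1 : ℝ) else 0) = Γ.degree v := by
    rw [Finset.sum_boole, ← SimpleGraph.card_neighborFinset_eq_degree]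
    congr 2
    ext; simp [Γ.adj_comm]
  rw [h3, h2] at h1
  simp only [Finset.sum_ite_eq', Finset.mem_univ, if_true] at h1
  linarith

theorem mul_sub_le (h : SpectralData Γ s t α) (ht : 2 ≤ t) (x v : V) :
    α v * (α x - α v) ≤ 2 * t - 2 := by
  by_cases hxv : x = v
  · subst hxv; simp; linarith
  have hd := h.sq v
  by_cases hadj : Γ.Adj x v
  · have h1 := h.adj x v hadj
    have h2 : Γ.neighborFinset x ∩ Γ.neighborFinset v ⊆ (Γ.neighborFinset v).erase x := by
      intro w hw
      simp only [Finset.mem_inter, SimpleGraph.mem_neighborFinset] at hw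
      simp only [Finset.mem_erase, SimpleGraph.mem_neighborFinset]
      exact ⟨(Γ.ne_of_adj hw.1).symm, hw.2⟩
    have h3 := Finset.card_le_card h2
    rw [Finset.card_erase_of_mem (by simpa using hadj.symm),
      SimpleGraph.card_neighborFinset_eq_degree] at h3
    have h4 : 0 < Γ.degree v := by
      rw [← SimpleGraph.card_neighborFinset_eq_degree, Finset.card_pos]
      exact ⟨x, by simpa using hadj.symm⟩
    have h5 : ((Γ.neighborFinset x ∩ Γ.neighborFinset v).card : ℝ) + 1 ≤ Γ.degree v := by
      exact_mod_cast (by omega)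
    nlinarith
  · have h1 := h.nonadj x v hxv hadj
    have h3 := Finset.card_le_card (Finset.inter_subset_right (s₁ := Γ.neighborFinset x)
      (s₂ := Γ.neighborFinset v))
    rw [SimpleGraph.card_neighborFinset_eq_degree] at h3
    have h5 : ((Γ.neighborFinset x ∩ Γ.neighborFinset v).card : ℝ) ≤ Γ.degree v := by
      exact_mod_cast h3
    nlinarith

theorem mul_sub_le_of_card_compl_le (h : SpectralData Γ s t α) {x : V}
    (hx : ∀ v, α v ≤ α x) {K : ℝ} (hK0 : 0 ≤ K)
    (hK : ∀ u w, Γ.Adj u w →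
      (((Γ.neighborFinset u ∪ Γ.neighborFinset w)ᶜ : Finset V).card : ℝ) ≤ K) (v : V) :
    α v * (α x - α v) ≤ K := by
  have hv := h.pos v
  have hxp := h.pos x
  rcases (hx v).eq_or_lt with hvx | hvx
  · rw [hvx, sub_self, mul_zero]
    exact hK0
  have hne : x ≠ v := by rintro rfl; exact lt_irrefl _ hvx
  have hcommon : ∀ w, Γ.Adj x w → Γ.Adj v w → α v * (α x - α v) ≤ K := by
    intro w hxw hvw
    have h1 := hK v w hvw
    rw [h.card_compl_union_neighborFinset hvw] at h1
    have h2 := h.card_compl_union_neighborFinset hxw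
    have h3 : (0 : ℝ) ≤ (((Γ.neighborFinset x ∪ Γ.neighborFinset w)ᶜ : Finset V).card : ℝ) := by
      positivity
    rw [h2] at h3
    nlinarith [mul_nonneg (sub_nonneg.mpr hvx.le) (sub_nonneg.mpr (hx w))]
  rcases (Γ.neighborFinset x ∩ Γ.neighborFinset v).eq_empty_or_nonempty with he | ⟨w, hw⟩
  · by_cases hadj : Γ.Adj x v
    · have h1 := h.adj x v hadj
      rw [he, Finset.card_empty, Nat.cast_zero] at h1
      have hnb : ∀ u ∈ Γ.neighborFinset v, α u = α x := by
        intro u hu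
        have h2 := h.adj u v (by simpa [Γ.adj_comm] using hu)
        have h3 : (0 : ℝ) ≤ ((Γ.neighborFinset u ∩ Γ.neighborFinset v).card : ℝ) := by positivity
        refine le_antisymm (hx u) ?_
        have : α x * α v ≤ α u * α v := by linarith
        exact le_of_mul_le_mul_right this hv
      have h4 := h.eig v
      rw [Finset.sum_congr rfl hnb, Finset.sum_const, SimpleGraph.card_neighborFinset_eq_degree,
        nsmul_eq_mul] at h4
      have h5 : s * α x ≤ Γ.degree x * α x := by
        rw [← h.eig x, ← nsmul_eq_mul, ← SimpleGraph.card_neighborFinset_eq_degree]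
        exact Finset.sum_le_card_nsmul _ _ _ fun w _ => hx w
      have h6 : s ≤ Γ.degree x := le_of_mul_le_mul_right h5 hxp
      have h7 := h.sq x
      have h8 := h.sq v
      have h9 : s * α v ≤ (α x ^ 2 + t) * α v := by
        apply mul_le_mul_of_nonneg_right _ hv.le; linarith
      have h10 : (α v ^ 2 + t) * α x = s * α v := by rw [← h4]; rw [h8]; ring
      have h11 : (α x - α v) * (α x * α v - t) = (α x ^ 2 + t) * α v - (α v ^ 2 + t) * α x := by
        ring
      have h12 : α x * α v - t = -1 := by linarith
      rw [h12] at h11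
      linarith
    · have h1 := h.nonadj x v hne hadj
      rw [he, Finset.card_empty, Nat.cast_zero] at h1
      have := mul_pos hxp hv
      linarith
  · simp only [Finset.mem_inter, SimpleGraph.mem_neighborFinset] at hw
    exact hcommon w hw.1 hw.2

theorem exists_int_eq (h : SpectralData Γ s t α) (ht : 2 ≤ t)
    (hnonreg : ¬ ∃ k, Γ.IsRegularOfDegree k) (u₀ v₀ : V)
    (hadj : Γ.Adj u₀ v₀) : ∃ T : ℤ, t = T := by
  obtain ⟨u, v, huv, hn⟩ : ∃ u v, u ≠ v ∧ ¬ Γ.Adj u v := by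
    by_contra! hcon
    apply hnonreg
    have : Γ = ⊤ := by
      ext u v
      exact ⟨fun h => Γ.ne_of_adj h, fun h => hcon u v h⟩
    refine ⟨Fintype.card V - 1, fun v => ?_⟩
    subst this
    convert SimpleGraph.complete_graph_degree v
  obtain ⟨q, hq⟩ : ∃ q : ℚ, t = q := by
    have h1 := h.adj u₀ v₀ hadj
    have h2 := h.sq u₀
    have h3 := h.sq v₀
    have h4 := sq_pos_of_pos (h.pos u₀)
    have h5 := sq_pos_of_pos (h.pos v₀)
    set β := (Γ.neighborFinset u₀ ∩ Γ.neighborFinset v₀).card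
    refine ⟨((Γ.degree u₀ : ℚ) * Γ.degree v₀ - (β - 1) ^ 2) /
      (Γ.degree u₀ + Γ.degree v₀ + 2 * β - 2), ?_⟩
    have hb : (0 : ℝ) ≤ β := by positivity
    push_cast
    rw [eq_div_iff (by linarith)]
    have e1 : α u₀ * α v₀ = β + t - 1 := by linarith
    have e2 : α u₀ ^ 2 * α v₀ ^ 2 = (β + t - 1) ^ 2 := by rw [← e1]; ring
    rw [h2, h3] at e2
    linear_combination -e2
  have hZ : IsIntegral ℤ q := by
    have h1 := h.nonadj u v huv hn
    have h2 := h.sq u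
    have h3 := h.sq v
    set β := (Γ.neighborFinset u ∩ Γ.neighborFinset v).card
    have e2 : α u ^ 2 * α v ^ 2 = (β : ℝ) ^ 2 := by rw [h1]; ring
    rw [h2, h3, hq] at e2
    have e3 : (Γ.degree u - q) * (Γ.degree v - q) = (β : ℚ) ^ 2 := by exact_mod_cast e2
    refine ⟨(Polynomial.X - Polynomial.C (Γ.degree u : ℤ)) *
      (Polynomial.X - Polynomial.C (Γ.degree v : ℤ)) - Polynomial.C ((β : ℤ) ^ 2), ?_, ?_⟩
    · refine Polynomial.Monic.sub_of_left ((Polynomial.monic_X_sub_C _).mul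
        (Polynomial.monic_X_sub_C _)) ?_
      refine Polynomial.degree_C_le.trans_lt ?_
      rw [Polynomial.degree_mul, Polynomial.degree_X_sub_C, Polynomial.degree_X_sub_C]
      norm_num
    · simp only [Polynomial.eval₂_sub, Polynomial.eval₂_mul, Polynomial.eval₂_X,
        Polynomial.eval₂_C]
      simp
      linear_combination e3
  obtain ⟨T, hT⟩ := IsIntegrallyClosed.isIntegral_iff.mp hZ
  refine ⟨T, ?_⟩
  rw [hq, ← hT]
  simp

end SpectralData

theorem endgame_large {t a P : ℝ} (ht : 30 ≤ t) (ha : 4 ≤ a) (haP : 4 * a ≤ P)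
    (hPt : P ≤ 2 * t - 2)
    (hP : (t - 1) * a ^ 2 * P ≤
      4 * a ^ 4 + 4 * a ^ 2 * P + 2 * P ^ 2 + 4 * t * a ^ 2 + 2 * t * P - 8 * a ^ 2) : False := by
  have h1 : 0 ≤ a ^ 2 * (t - 5) - 6 * t + 4 := by
    have : 16 ≤ a ^ 2 := by nlinarith
    nlinarith [mul_le_mul_of_nonneg_right this (show 0 ≤ t - 5 by linarith)]
  have h2 : P * (a ^ 2 * (t - 5) - 6 * t + 4) ≤ 4 * a ^ 4 + 4 * t * a ^ 2 - 8 * a ^ 2 := by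
    have : P * P ≤ P * (2 * t - 2) := mul_le_mul_of_nonneg_left hPt (by linarith)
    nlinarith
  have h3 : 4 * a * (a ^ 2 * (t - 5) - 6 * t + 4) ≤ 4 * a ^ 4 + 4 * t * a ^ 2 - 8 * a ^ 2 :=
    (mul_le_mul_of_nonneg_right haP h1).trans h2
  have h4 : a * ((a ^ 2 - a - 6) * t - a ^ 3 - 5 * a ^ 2 + 2 * a + 4) ≤ 0 := by nlinarith
  have h5 : (a ^ 2 - a - 6) * t - a ^ 3 - 5 * a ^ 2 + 2 * a + 4 ≤ 0 := by
    by_contra! hcon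
    have := mul_pos (show 0 < a by linarith) hcon
    linarith
  have h6 : 0 ≤ a ^ 2 - a - 6 := by nlinarith
  rcases le_total a 14 with h | h
  · have h7 := mul_le_mul_of_nonneg_left ht h6
    have : 0 < -a ^ 3 + 25 * a ^ 2 - 28 * a - 176 := by
      nlinarith [mul_nonneg (sub_nonneg.mpr ha) (sub_nonneg.mpr h),
        mul_nonneg (mul_nonneg (sub_nonneg.mpr ha) (sub_nonneg.mpr h)) (show 0 ≤ a by linarith)]
    linarith
  · have h7 := mul_le_mul_of_nonneg_left (show 2 * a + 1 ≤ t by linarith) h6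
    have : 0 < a ^ 3 - 6 * a ^ 2 - 11 * a - 2 := by
      nlinarith [mul_nonneg (sub_nonneg.mpr h) (sub_nonneg.mpr h),
        mul_nonneg (mul_nonneg (sub_nonneg.mpr h) (sub_nonneg.mpr h)) (show 0 ≤ a by linarith)]
    nlinarith

theorem endgame_medium {t g h : ℝ} (ht : 30 ≤ t) (hg : 8 ≤ g) (hg' : g ≤ 15) (hh : -1 ≤ h)
    (hh' : h ≤ t + g - 2)
    (hR : g * (t - 1) * (t + h - g) ≤
      2 * (2 * t ^ 2 + 3 * t * h + h ^ 2 + g ^ 2 + t * g - 4 * g)) : False := by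
  have h1 : 0 ≤ (h + 1) * (t + g - 2 - h) := mul_nonneg (by linarith) (by linarith)
  have h2 : 0 ≤ (g - 8) * (15 - g) := mul_nonneg (by linarith) (by linarith)
  have h3 : 0 ≤ (g - 8) * (t * (h + 1)) :=
    mul_nonneg (by linarith) (mul_nonneg (by linarith) (by linarith))
  have h4 : 0 ≤ (3 * g - 6) * (t + g - 2 - h) := mul_nonneg (by linarith) (by linarith)
  have h5 : 0 ≤ (g - 8) * (t - 30) := mul_nonneg (by linarith) (by linarith)
  have h6 : 0 ≤ (g - 8) * (15 - g) * t := mul_nonneg h2 (by linarith)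
  have h7 : 0 ≤ (g - 8) * (t - 30) ^ 2 := mul_nonneg (by linarith) (sq_nonneg _)
  nlinarith

theorem false_of_forall_mul_le {X Y Q N R c num den : ℝ} (hc : 0 < c) (hnum : 0 < num)
    (hden : 0 < den)
    (H : ∀ r, 0 < r → r ^ 2 ≤ Q + R / c → 2 * X * r ≤ 2 * Y + R / c * (N + R / c))
    (h2 : num ^ 2 * c ≤ (Q * c + R) * den ^ 2)
    (h1 : (2 * Y * c ^ 2 + R * (N * c + R)) * den < 2 * X * c ^ 2 * num) : False := by
  have hr := H (num / den) (div_pos hnum hden) (by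
    rw [div_pow, ← sub_nonneg]
    have : Q + R / c - num ^ 2 / den ^ 2 =
        ((Q * c + R) * den ^ 2 - num ^ 2 * c) / (c * den ^ 2) := by
      field_simp
    rw [this]
    exact div_nonneg (by linarith) (by positivity))
  have e1 : 2 * X * (num / den) - (2 * Y + R / c * (N + R / c)) =
      (2 * X * c ^ 2 * num - (2 * Y * c ^ 2 + R * (N * c + R)) * den) / (c ^ 2 * den) := by
    field_simp
  have : 0 < 2 * X * (num / den) - (2 * Y + R / c * (N + R / c)) := by
    rw [e1]
    exact div_pos (by linarith) (by positivity)
  linarith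

theorem endgame_small {t g h E : ℝ} (ht : 30 ≤ t)
    (hg : g = 1 ∨ g = 2 ∨ g = 3 ∨ g = 4 ∨ g = 5 ∨ g = 6 ∨ g = 7) (hh : 1 ≤ h)
    (hh' : h ≤ t + g - 2) (hE : (t + g) * h ^ 2 ≤ E)
    (H : ∀ G r, (t - 1) * G = 2 * ((t + h) ^ 2 + t ^ 2 + g ^ 2 + t * g - g * h - 4 * g +
        (t + g) * h) → 0 < r → r ^ 2 ≤ t ^ 2 + (t + g) * h + G →
      2 * (t ^ 3 + 3 * g * t ^ 2 + (2 * g ^ 2 - 2 * g) * t - g ^ 2 +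
        2 * t * ((t + g) * h) + E) * r ≤
      2 * ((t ^ 2 + t * g + (t + g) * h - g) * (t ^ 2 + 2 * t * g + (t + g) * h)) +
      G * (g ^ 2 + (t + h) ^ 2 - g * (t + h) + 3 * t * g - g + G)) : False := by
  set R := 2 * ((t + h) ^ 2 + t ^ 2 + g ^ 2 + t * g - g * h - 4 * g + (t + g) * h) with hR
  have hc : 0 < t - 1 := by linarith
  have H' := fun r => H (R / (t - 1)) r (mul_div_cancel₀ R hc.ne')
  obtain ⟨τ, rfl⟩ : ∃ τ, t = 30 + τ := ⟨t - 30, by ring⟩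
  have hτ : 0 ≤ τ := by linarith
  rcases le_total h 13 with h13 | h13
  · obtain ⟨η, rfl⟩ : ∃ η, h = 1 + η := ⟨h - 1, by ring⟩
    have hη : 0 ≤ η := by linarith
    have hm : ∀ i j : ℕ, 0 ≤ τ ^ i * η ^ j := fun i j => by positivity
    have hd : ∀ i j : ℕ, 0 ≤ τ ^ i * η ^ j * (12 - η) := fun i j =>
      mul_nonneg (hm i j) (by linarith)
    have hg0 : 0 < g := by rcases hg with rfl | rfl | rfl | rfl | rfl | rfl | rfl <;> norm_num
    refine false_of_forall_mul_le
      (num := (30 + τ + 2 + (1 + η) / 2) * (2 * (30 + τ) + 14) + 3 * g + 7 / 2)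
      (den := 2 * (30 + τ) + 14) hc (by positivity) (by positivity) H' ?_ ?_
    · rw [hR]
      rcases hg with rfl | rfl | rfl | rfl | rfl | rfl | rfl <;>
      linarith [hm 0 1, hm 1 0, hm 1 1, hm 2 0, hm 2 1, hm 3 0, hm 3 1, hm 4 0, hm 4 1,
        hd 0 1, hd 1 1, hd 2 1, hd 3 1]
    · have hE' := mul_le_mul_of_nonneg_right hE
        (show 0 ≤ 2 * (30 + τ - 1) ^ 2 * ((30 + τ + 2 + (1 + η) / 2) * (2 * (30 + τ) + 14) +
          3 * g + 7 / 2) by positivity)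
      rw [hR]
      rcases hg with rfl | rfl | rfl | rfl | rfl | rfl | rfl <;>
      linarith [sq_nonneg (η - 9 / 10), hm 0 0, hm 0 1, hm 0 2, hm 0 3,
        hm 1 0, hm 1 1, hm 1 2, hm 1 3, hm 2 0, hm 2 1, hm 2 2, hm 2 3, hm 3 0,
        hm 3 1, hm 3 2, hm 3 3, hm 4 0, hm 4 1, hm 4 2, hm 4 3, hm 5 0,
        hm 5 1, hm 5 2, hm 6 0, hm 6 1,
        hd 0 3, hd 1 3, hd 2 3]
  · obtain ⟨η, rfl⟩ : ∃ η, h = 13 + η := ⟨h - 13, by ring⟩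
    have hη : 0 ≤ η := by linarith
    have hm : ∀ i j : ℕ, 0 ≤ τ ^ i * η ^ j := fun i j => by positivity
    have hg7 : g ≤ 7 := by rcases hg with rfl | rfl | rfl | rfl | rfl | rfl | rfl <;> norm_num
    have hd : ∀ i j : ℕ, 0 ≤ τ ^ i * η ^ j * (τ + 22 - η) := fun i j =>
      mul_nonneg (hm i j) (by linarith)
    refine false_of_forall_mul_le (num := 30 + τ + 4 + (13 + η) / 3) (den := 1) hc (by positivity)
      one_pos H' ?_ ?_
    · rw [hR]
      rcases hg with rfl | rfl | rfl | rfl | rfl | rfl | rfl <;>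
      linarith [hm 0 1, hm 1 0, hm 1 1, hm 2 0, hm 2 1, hm 3 0, hm 3 1, hd 0 1, hd 1 1]
    · have hE' := mul_le_mul_of_nonneg_right hE
        (show 0 ≤ 2 * (30 + τ - 1) ^ 2 * (30 + τ + 4 + (13 + η) / 3) by positivity)
      rw [hR]
      rcases hg with rfl | rfl | rfl | rfl | rfl | rfl | rfl <;>
      linarith [hm 0 1, hm 0 2, hm 0 3, hm 1 0, hm 1 1, hm 1 2, hm 1 3,
        hm 2 0, hm 2 1, hm 2 2, hm 2 3, hm 3 0,
        hm 3 1, hm 3 2, hm 3 3, hm 4 0, hm 4 1, hm 4 2, hm 5 0, hm 5 1,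
        hd 0 3, hd 1 3]

theorem endgame_neg_one {t g h E : ℝ} (ht : 30 ≤ t)
    (hg : g = 1 ∨ g = 2 ∨ g = 3 ∨ g = 4 ∨ g = 5 ∨ g = 6 ∨ g = 7) (hh : -1 ≤ h)
    (hh' : h ≤ 1)
    (hE : t ^ 3 - (1 + g) * t ^ 2 + (2 * g - g ^ 2) * t + g ^ 3 - g ^ 2 - g ≤ E * (t - 1))
    (H : ∀ G r, (t - 1) * G = 2 * ((t + -1) ^ 2 + t ^ 2 + g ^ 2 + t * g - g * (-1) - 4 * g +
        (t + g) * h) → 0 < r → r ^ 2 ≤ t ^ 2 + (t + g) * h + G →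
      2 * (t ^ 3 + 3 * g * t ^ 2 + (2 * g ^ 2 - 2 * g) * t - g ^ 2 +
        2 * t * ((t + g) * h) + E) * r ≤
      2 * ((t ^ 2 + t * g + (t + g) * h - g) * (t ^ 2 + 2 * t * g + (t + g) * h)) +
      G * (g ^ 2 + (t + -1) ^ 2 - g * (t + -1) + 3 * t * g - g + G)) : False := by
  set R := 2 * ((t + -1) ^ 2 + t ^ 2 + g ^ 2 + t * g - g * (-1) - 4 * g + (t + g) * h) with hR
  have hc : 0 < t - 1 := by linarith
  have H' := fun r => H (R / (t - 1)) r (mul_div_cancel₀ R hc.ne')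
  obtain ⟨τ, rfl⟩ : ∃ τ, t = 30 + τ := ⟨t - 30, by ring⟩
  have hτ : 0 ≤ τ := by linarith
  obtain ⟨η, rfl⟩ : ∃ η, h = -1 + η := ⟨h + 1, by ring⟩
  have hη : 0 ≤ η := by linarith
  have hm : ∀ i j : ℕ, 0 ≤ τ ^ i * η ^ j := fun i j => by positivity
  have hd : ∀ i j : ℕ, 0 ≤ τ ^ i * η ^ j * (2 - η) := fun i j =>
    mul_nonneg (hm i j) (by linarith)
  have hnum : 0 < 30 + τ + 15 / 8 + (-1 + η) / 2 := by linarith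
  refine false_of_forall_mul_le (num := 30 + τ + 15 / 8 + (-1 + η) / 2) (den := 1) hc hnum
    one_pos H' ?_ ?_
  · rw [hR]
    rcases hg with rfl | rfl | rfl | rfl | rfl | rfl | rfl <;>
    linarith [hm 0 1, hm 1 0, hm 1 1, hm 2 0, hm 2 1, hm 3 0, hm 3 1, hd 0 1, hd 1 1]
  · have hE' := mul_le_mul_of_nonneg_right hE
      (show 0 ≤ 2 * (30 + τ - 1) * (30 + τ + 15 / 8 + (-1 + η) / 2) from
        mul_nonneg (by linarith) hnum.le)
    rw [hR]
    rcases hg with rfl | rfl | rfl | rfl | rfl | rfl | rfl <;>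
    linarith [hm 0 1, hm 1 0, hm 1 1, hm 2 0, hm 2 1, hm 3 0, hm 3 1,
        hm 4 0, hm 4 1, hm 5 0, hm 5 1,
      hd 0 1, hd 1 1, hd 2 1, hd 3 1]

theorem endgame_zero {t g E : ℝ} (ht : 30 ≤ t)
    (hg : g = 3 ∨ g = 4 ∨ g = 5 ∨ g = 6 ∨ g = 7) (hE : 0 ≤ E) (hE' : E ≤ t + g)
    (h : (t - 1) * (2 * g * t ^ 2 - 3 * g ^ 2 * t + g ^ 3) ≤
      2 * (2 * t ^ 2 + g ^ 2 + t * g - 4 * g + E) * E) : False := by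
  have hg0 : 0 ≤ g := by rcases hg with rfl | rfl | rfl | rfl | rfl <;> norm_num
  have hpos : 0 ≤ 2 * t ^ 2 + g ^ 2 + t * g - 4 * g + E := by nlinarith
  have h1 : (2 * t ^ 2 + g ^ 2 + t * g - 4 * g + E) * E ≤
      (2 * t ^ 2 + g ^ 2 + t * g - 4 * g + (t + g)) * (t + g) := by
    apply mul_le_mul _ hE' hE <;> linarith
  obtain ⟨τ, rfl⟩ : ∃ τ, t = 30 + τ := ⟨t - 30, by ring⟩
  have hτ : 0 ≤ τ := by linarith
  have hm : ∀ i : ℕ, 0 ≤ τ ^ i := fun i => by positivity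
  rcases hg with rfl | rfl | rfl | rfl | rfl <;> linarith [hm 1, hm 2, hm 3]

namespace SpectralData

variable {V : Type*} [Fintype V] [DecidableEq V] {Γ : SimpleGraph V} [DecidableRel Γ.Adj]
  {s t : ℝ} {α : V → ℝ}

theorem degree_eq (h : SpectralData Γ s t α) (v : V) : (Γ.degree v : ℝ) = α v ^ 2 + t := by
  rw [h.sq]; ring

theorem sum_neighborFinset_mul_sub (h : SpectralData Γ s t α) (y z : V) :
    ∑ u ∈ Γ.neighborFinset z, (α y * α u - t) = s * (α y * α z) - (α z ^ 2 + t) * t := by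
  rw [Finset.sum_sub_distrib, ← Finset.mul_sum, h.eig, Finset.sum_const,
    SimpleGraph.card_neighborFinset_eq_degree, nsmul_eq_mul, h.degree_eq]
  ring

theorem sum_neighborFinset_mul_sub_sq (h : SpectralData Γ s t α) (y z : V) :
    ∑ u ∈ Γ.neighborFinset z, (α y * α u - t) ^ 2 =
      α y ^ 2 * (α z * ∑ v, α v - (2 * t - 1) * (α z ^ 2 + t) + t) -
        2 * t * (s * (α y * α z)) + t ^ 2 * (α z ^ 2 + t) := by
  have h1 : ∀ u, (α y * α u - t) ^ 2 =
      α y ^ 2 * α u ^ 2 - 2 * t * α y * α u + t ^ 2 := fun u => by ring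
  simp only [h1]
  rw [Finset.sum_add_distrib, Finset.sum_sub_distrib, ← Finset.mul_sum, ← Finset.mul_sum, h.eig,
    Finset.sum_const, SimpleGraph.card_neighborFinset_eq_degree, nsmul_eq_mul, h.degree_eq,
    h.mul_sum]
  ring

/-- The inequality obtained by summing `α v * (α x - α v) ^ 2 ≤ K * (α x - α v)` over all
vertices, scaled by powers of `α y`. -/
theorem two_mul_mul_le (h : SpectralData Γ s t α) {x y : V} (hx : ∀ v, α v ≤ α x) {K G M r : ℝ}
    (hK : ∀ v, α v * (α x - α v) ≤ K) (hG : α y ^ 2 * K ≤ G)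
    (hM : α y ^ 2 * Fintype.card V ≤ M)
    (hrQ : r ^ 2 ≤ α y ^ 2 * (s - t) + G) :
    2 * (α y ^ 3 * ∑ v, α v) * r ≤ 2 * (α y ^ 4 * ((s - 1) * (s + t))) + G * M := by
  have hy := h.pos y
  have hxp := h.pos x
  set σ := ∑ v, α v with hσ
  have hσ0 : 0 ≤ σ := Finset.sum_nonneg fun v _ => (h.pos v).le
  have h1 : ∑ v, α v * (α x - α v) ^ 2 ≤ ∑ v, K * (α x - α v) :=
    Finset.sum_le_sum fun v _ => by
      nlinarith [mul_le_mul_of_nonneg_right (hK v) (sub_nonneg.mpr (hx v))]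
  have h2 : ∑ v, α v * (α x - α v) ^ 2 =
      α x ^ 2 * σ - 2 * α x * ((s - 1) * (s + t)) + (s - t) * σ := by
    rw [← h.sum_pow_three, ← h.norm, hσ, Finset.mul_sum, Finset.mul_sum,
      ← Finset.sum_sub_distrib, ← Finset.sum_add_distrib]
    exact Finset.sum_congr rfl fun v _ => by ring
  have h3 : ∑ v, K * (α x - α v) = K * (Fintype.card V * α x - σ) := by
    rw [← Finset.mul_sum, Finset.sum_sub_distrib, Finset.sum_const, Finset.card_univ,
      nsmul_eq_mul]
  have h4 : σ ≤ Fintype.card V * α x := by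
    rw [hσ, ← nsmul_eq_mul, ← Finset.card_univ]
    exact Finset.sum_le_card_nsmul _ _ _ fun v _ => hx v
  rw [h2, h3] at h1
  have hK0 : 0 ≤ K := by simpa using hK x
  have hG0 : 0 ≤ G := (mul_nonneg (sq_nonneg _) hK0).trans hG
  have h5 : α y ^ 2 * K * (Fintype.card V * α x - σ) ≤ G * (Fintype.card V * α x - σ) :=
    mul_le_mul_of_nonneg_right hG (by linarith)
  have h6 : G * (α y ^ 2 * Fintype.card V) ≤ G * M := mul_le_mul_of_nonneg_left hM hG0
  have h7 : 2 * (α x * α y) * r ≤ (α x * α y) ^ 2 + (α y ^ 2 * (s - t) + G) := by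
    nlinarith [sq_nonneg (α x * α y - r)]
  have h8 := mul_le_mul_of_nonneg_left h7 (mul_nonneg (pow_nonneg hy.le 3) hσ0)
  have h9 := mul_le_mul_of_nonneg_left h1 (pow_nonneg hy.le 5)
  have h10 := mul_le_mul_of_nonneg_left h5 (pow_nonneg hy.le 3)
  have h11 := mul_le_mul_of_nonneg_left h6 (mul_nonneg hxp.le hy.le)
  have h12 : 0 < α x * α y := mul_pos hxp hy
  refine le_of_mul_le_mul_left ?_ h12
  linarith

theorem mul_card_le (h : SpectralData Γ s t α) {y z : V} {K : ℝ}
    (hK : (((Γ.neighborFinset y ∪ Γ.neighborFinset z)ᶜ : Finset V).card : ℝ) ≤ K)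
    (hyz : Γ.Adj y z) {g e E : ℝ} (hg : α y ^ 2 = g) (he : α y * α z = t + e)
    (hE : g * s = t ^ 2 + t * g + E)
    (hKn : (1 + t) * (K + 4) = 2 * (Fintype.card V + s - 1)) :
    g * Fintype.card V ≤ g ^ 2 + (t + e) ^ 2 - g * (t + e) + 3 * t * g - g + g * K ∧
    (t - 1) * (g * K) ≤ 2 * ((t + e) ^ 2 + t ^ 2 + g ^ 2 + t * g - g * e - 4 * g + E) := by
  have h1 := h.card_compl_union_neighborFinset hyz
  rw [h1] at hK
  have hg0 : 0 ≤ g := hg ▸ sq_nonneg _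
  have h2 : g * α z ^ 2 = (t + e) ^ 2 := by rw [← he, ← hg]; ring
  have h3 := mul_le_mul_of_nonneg_left hK hg0
  rw [he, hg] at h3
  have h4 : g * Fintype.card V ≤ g ^ 2 + (t + e) ^ 2 - g * (t + e) + 3 * t * g - g + g * K := by
    linarith
  refine ⟨h4, ?_⟩
  have h5 : g * ((1 + t) * (K + 4)) = g * (2 * (Fintype.card V + s - 1)) := by rw [hKn]
  linarith

theorem two_mul_mul_le_of_adj (h : SpectralData Γ s t α) (ht : 30 ≤ t) {x y z : V}
    (hx : ∀ v, α v ≤ α x) {K g e e' E F : ℝ} (hK : ∀ v, α v * (α x - α v) ≤ K)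
    (hC : (((Γ.neighborFinset y ∪ Γ.neighborFinset z)ᶜ : Finset V).card : ℝ) ≤ K)
    (hyz : Γ.Adj y z) (hg : α y ^ 2 = g) (hg' : g ≤ 2 * t - 2) (he : α y * α z = t + e)
    (he0 : -1 ≤ e) (hee : e ≤ e') (hE : g * s = t ^ 2 + t * g + E)
    (hF : α y ^ 3 * ∑ v, α v =
      t ^ 3 + 3 * g * t ^ 2 + (2 * g ^ 2 - 2 * g) * t - g ^ 2 + 2 * t * E + F)
    (hKn : (1 + t) * (K + 4) = 2 * (Fintype.card V + s - 1)) {G r : ℝ}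
    (hG : (t - 1) * G =
      2 * ((t + e') ^ 2 + t ^ 2 + g ^ 2 + t * g - g * e' - 4 * g + E))
    (hrQ : r ^ 2 ≤ t ^ 2 + E + G) :
    2 * (t ^ 3 + 3 * g * t ^ 2 + (2 * g ^ 2 - 2 * g) * t - g ^ 2 + 2 * t * E + F) * r ≤
      2 * ((t ^ 2 + t * g + E - g) * (t ^ 2 + 2 * t * g + E)) +
      G * (g ^ 2 + (t + e') ^ 2 - g * (t + e') + 3 * t * g - g + G) := by
  obtain ⟨h1, h2⟩ := h.mul_card_le hC hyz hg he hE hKn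
  have h3 : 0 ≤ (e' - e) * (2 * t + e + e' - g) := mul_nonneg (by linarith) (by linarith)
  have h4 : g * K ≤ G := by
    refine le_of_mul_le_mul_left ?_ (show 0 < t - 1 by linarith)
    linarith
  have h5 := h.two_mul_mul_le hx hK (y := y) (G := G)
    (M := g ^ 2 + (t + e') ^ 2 - g * (t + e') + 3 * t * g - g + G) (r := r)
    (by rwa [hg]) (by rw [hg]; linarith) (by rw [hg]; linarith)
  have h6 : α y ^ 4 * ((s - 1) * (s + t)) =
      (t ^ 2 + t * g + E - g) * (t ^ 2 + 2 * t * g + E) := by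
    have e1 : t ^ 2 + t * g + E - g = g * s - g := by rw [hE]
    have e2 : t ^ 2 + 2 * t * g + E = g * s + g * t := by rw [hE]; ring
    rw [e1, e2, ← hg]; ring
  rw [hF, h6] at h5
  exact h5

/-- Lower bound on the second moment of `u ↦ α y * α u - t` over the neighbours of `y`, obtained
by comparing with the contribution of `y` to the same sum over the neighbours of `z`. -/
theorem le_mul_second_moment (h : SpectralData Γ s t α) {y z : V}
    (hyz : Γ.Adj y z) {g f E F : ℝ} (hg : α y ^ 2 = g) (hf : α y * α z = t + f)
    (hE : g * s = t ^ 2 + t * g + E)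
    (hF : α y ^ 3 * ∑ v, α v =
      t ^ 3 + 3 * g * t ^ 2 + (2 * g ^ 2 - 2 * g) * t - g ^ 2 + 2 * t * E + F) :
    g * (g - t) ^ 2 ≤
      (t + f) * (t ^ 3 + 3 * g * t ^ 2 + (2 * g ^ 2 - 2 * g) * t - g ^ 2 + 2 * t * E + F) -
        g * (2 * t - 1) * (g * t + (t + f) ^ 2) + g ^ 2 * t -
        2 * t * (t + f) * (t ^ 2 + t * g + E) + t ^ 2 * (g * t + (t + f) ^ 2) := by
  have h1 : (α y * α y - t) ^ 2 ≤ ∑ u ∈ Γ.neighborFinset z, (α y * α u - t) ^ 2 :=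
    Finset.single_le_sum (f := fun u => (α y * α u - t) ^ 2) (fun u _ => sq_nonneg _)
      (by simpa using hyz.symm)
  rw [h.sum_neighborFinset_mul_sub_sq, ← pow_two, hg, hf] at h1
  have h2 : α z ^ 2 * g = (t + f) ^ 2 := by rw [← hf, ← hg]; ring
  have h3 : (t + f) * (α y ^ 3 * ∑ v, α v) = g * (g * (α z * ∑ v, α v)) := by
    rw [← hf, ← hg]; ring
  rw [hF] at h3
  have hg0 : 0 ≤ g := hg ▸ sq_nonneg _
  have h4 := mul_le_mul_of_nonneg_left h1 hg0
  rw [h3, ← hE]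
  linear_combination h4 + (t ^ 2 - g * (2 * t - 1)) * h2

set_option maxHeartbeats 2000000 in
theorem lt_of_gap (h : SpectralData Γ s t α) (hT : ∃ T : ℤ, t = T) {x y : V}
    (hx : ∀ v, α v ≤ α x) (hgap : α y ≤ α x - 4) {K : ℝ} (hK0 : 0 ≤ K)
    (hC : ∀ u w, Γ.Adj u w →
      (((Γ.neighborFinset u ∪ Γ.neighborFinset w)ᶜ : Finset V).card : ℝ) ≤ K)
    (hKn : (1 + t) * (K + 4) = 2 * (Fintype.card V + s - 1)) : t < 30 := by
  by_contra! ht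
  have hy := h.pos y
  have hK := h.mul_sub_le_of_card_compl_le hx hK0 hC
  have hK2 := h.mul_sub_le (by linarith) x
  obtain ⟨g, hg⟩ : ∃ g, α y ^ 2 = g := ⟨_, rfl⟩
  have hg0 : 0 < g := hg ▸ pow_pos hy 2
  obtain ⟨E, hEdef⟩ : ∃ E, ∑ u ∈ Γ.neighborFinset y, (α y * α u - t) = E := ⟨_, rfl⟩
  obtain ⟨F, hFdef⟩ : ∃ F, ∑ u ∈ Γ.neighborFinset y, (α y * α u - t) ^ 2 = F := ⟨_, rfl⟩
  have hE : g * s = t ^ 2 + t * g + E := by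
    rw [← hEdef, h.sum_neighborFinset_mul_sub, ← hg]; ring
  have hF : α y ^ 3 * ∑ v, α v =
      t ^ 3 + 3 * g * t ^ 2 + (2 * g ^ 2 - 2 * g) * t - g ^ 2 + 2 * t * E + F := by
    have h1 := h.sum_neighborFinset_mul_sub_sq y y
    have h2 : s * (α y * α y) = g * s := by rw [← hg]; ring
    rw [h2, hE, hFdef, hg] at h1
    rw [h1, ← hg]; ring
  have hdeg : ((Γ.neighborFinset y).card : ℝ) = t + g := by
    rw [SimpleGraph.card_neighborFinset_eq_degree, h.degree_eq, hg, add_comm]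
  have hne : (Γ.neighborFinset y).Nonempty := by
    rw [← Finset.card_pos]
    have : (0 : ℝ) < (Γ.neighborFinset y).card := by rw [hdeg]; linarith
    exact_mod_cast this
  have hmem : ∀ {z}, z ∈ Γ.neighborFinset y ↔ Γ.Adj y z := by simp
  have hZ : ∀ z ∈ Γ.neighborFinset y, ∃ k : ℤ, α y * α z - t = k ∧ -1 ≤ k := by
    intro z hz
    refine ⟨((Γ.neighborFinset y ∩ Γ.neighborFinset z).card : ℤ) - 1, ?_, by omega⟩
    have := h.adj y z (hmem.mp hz)
    push_cast
    linarith
  have hm1 : ∀ z ∈ Γ.neighborFinset y, -1 ≤ α y * α z - t := by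
    intro z hz
    obtain ⟨k, hk, hk1⟩ := hZ z hz
    rw [hk]; exact_mod_cast hk1
  have hB : ∀ z, α y * α z ≤ α y * α x := fun z => mul_le_mul_of_nonneg_left (hx z) hy.le
  have hm : 0 < t + g := by linarith
  obtain ⟨e, hEe⟩ : ∃ e, E = (t + g) * e := ⟨E / (t + g), by field_simp⟩
  have hBe : t + e ≤ α y * α x := by
    have h1 : E ≤ (Γ.neighborFinset y).card • (α y * α x - t) := by
      rw [← hEdef]
      exact Finset.sum_le_card_nsmul _ _ _ fun z _ => by linarith [hB z]
    rw [nsmul_eq_mul, hdeg, hEe] at h1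
    have := le_of_mul_le_mul_left h1 hm
    linarith
  have he1 : -1 ≤ e := by
    have h1 : (Γ.neighborFinset y).card • (-1 : ℝ) ≤ E := by
      rw [← hEdef]
      exact Finset.card_nsmul_le_sum _ _ _ hm1
    rw [nsmul_eq_mul, hdeg, hEe] at h1
    exact le_of_mul_le_mul_left h1 hm
  obtain ⟨z₀, hz₀, hmin⟩ := Finset.exists_min_image _ (fun z => α y * α z - t) hne
  have hyz := hmem.mp hz₀
  obtain ⟨e₀, he₀⟩ : ∃ e₀, α y * α z₀ = t + e₀ := ⟨α y * α z₀ - t, by ring⟩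
  have he₀e : e₀ ≤ e := by
    have h1 : (Γ.neighborFinset y).card • e₀ ≤ E := by
      rw [← hEdef]
      exact Finset.card_nsmul_le_sum _ _ _ fun z hz => by linarith [hmin z hz]
    rw [nsmul_eq_mul, hdeg, hEe] at h1
    exact le_of_mul_le_mul_left h1 hm
  have he₀1 : -1 ≤ e₀ := by linarith [hm1 z₀ hz₀]
  obtain ⟨-, hR⟩ := h.mul_card_le (hC y z₀ hyz) hyz hg he₀ hE hKn
  obtain ⟨P, hP⟩ : ∃ P, α y * (α x - α y) = P := ⟨_, rfl⟩
  have hPK : P ≤ K := hP ▸ hK y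
  have hPt : P ≤ 2 * t - 2 := hP ▸ hK2 y
  have hPB : α y * α x = g + P := by rw [← hP, ← hg]; ring
  have hP4 : 4 * α y ≤ P := by
    rw [← hP, mul_comm]
    exact mul_le_mul_of_nonneg_left (by linarith) hy.le
  have hgPK : g * P ≤ g * K := mul_le_mul_of_nonneg_left hPK hg0.le
  rcases le_or_gt 4 (α y) with ha | ha
  · refine endgame_large ht ha hP4 hPt ?_
    have h1 : (t + e₀) * (t + e₀ - g) ≤ (g + P) * P := by
      have := hB z₀
      rw [he₀, hPB] at this
      have hP0 : 0 ≤ P := by linarith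
      rcases le_total (t + e₀) g with h1 | h1
      · refine (mul_nonpos_of_nonneg_of_nonpos ?_ (by linarith)).trans
          (mul_nonneg (by linarith) hP0)
        linarith
      · exact mul_le_mul this (by linarith) (by linarith) (by linarith)
    have h2 : (t + g) * (t + e) ≤ (t + g) * (g + P) :=
      mul_le_mul_of_nonneg_left (by linarith) hm.le
    have h3 : (t - 1) * (g * P) ≤ (t - 1) * (g * K) :=
      mul_le_mul_of_nonneg_left hgPK (by linarith)
    rw [hEe] at hR
    have h4 : α y ^ 4 = g ^ 2 := by rw [← hg]; ring
    rw [h4, hg]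
    linarith
  obtain ⟨T, rfl⟩ := hT
  obtain ⟨γ, rfl⟩ : ∃ γ : ℤ, g = γ := by
    refine ⟨Γ.degree y - T, ?_⟩
    have := h.sq y
    push_cast
    linarith
  have hγ1 : 1 ≤ γ := by exact_mod_cast hg0
  have hγ15 : γ ≤ 15 := by
    have : (γ : ℝ) < 16 := by rw [← hg]; nlinarith
    have : γ < 16 := by exact_mod_cast this
    omega
  have hγ15' : (γ : ℝ) ≤ 15 := by exact_mod_cast hγ15
  have hmono : 0 ≤ (e - e₀) * (2 * T + e + e₀ - γ) := mul_nonneg (by linarith) (by linarith)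
  have he2 : e ≤ T + γ - 2 := by linarith
  rcases le_or_gt 8 γ with h8 | h8
  · refine endgame_medium ht (by exact_mod_cast h8) hγ15' he1 he2 ?_
    have h1 : (γ : ℝ) * (T + e - γ) ≤ γ * K :=
      mul_le_mul_of_nonneg_left (by linarith) hg0.le
    have h2 := mul_le_mul_of_nonneg_left h1 (show (0 : ℝ) ≤ T - 1 by linarith)
    rw [hEe] at hR
    linarith
  have hγ : (γ : ℝ) = 1 ∨ (γ : ℝ) = 2 ∨ (γ : ℝ) = 3 ∨ (γ : ℝ) = 4 ∨ (γ : ℝ) = 5 ∨ (γ : ℝ) = 6 ∨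
      (γ : ℝ) = 7 := by
    interval_cases γ <;> norm_num
  have hg' : (γ : ℝ) ≤ 2 * T - 2 := by linarith
  rcases le_or_gt 1 e with h1e | h1e
  · refine endgame_small (E := F) ht hγ h1e he2 ?_ ?_
    · have h1 := sq_sum_le_card_mul_sum_sq (s := Γ.neighborFinset y)
        (f := fun u => α y * α u - (T : ℝ))
      rw [hEdef, hFdef, hdeg, hEe] at h1
      refine le_of_mul_le_mul_left ?_ hm
      linarith
    · intro G r hG _ hr
      rw [← hEe] at hG hr ⊢
      exact h.two_mul_mul_le_of_adj ht hx hK (hC y z₀ hyz) hyz hg hg' he₀ he₀1 he₀e hE hF hKn hG hr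
  obtain ⟨k, hk, hk1⟩ := hZ z₀ hz₀
  have hk' : e₀ = k := by linarith
  have hk2 : k < 1 := by
    have : (k : ℝ) < 1 := by linarith
    exact_mod_cast this
  have hmom := h.le_mul_second_moment hyz hg he₀ hE hF
  obtain rfl | rfl : k = -1 ∨ k = 0 := by omega
  · have hk'' : e₀ = -1 := by rw [hk']; norm_num
    subst hk''
    refine endgame_neg_one (E := F) ht hγ he1 h1e.le ?_ ?_
    · refine le_of_mul_le_mul_left ?_ (show (0 : ℝ) < 1 by norm_num)
      linarith
    · intro G r hG _ hr
      rw [← hEe] at hG hr ⊢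
      exact h.two_mul_mul_le_of_adj ht hx hK (hC y z₀ hyz) hyz hg hg' he₀ le_rfl le_rfl hE hF
        hKn hG hr
  · have hk'' : e₀ = 0 := by rw [hk']; norm_num
    subst hk''
    have hnn : ∀ z ∈ Γ.neighborFinset y, 0 ≤ α y * α z - T := fun z hz => by
      linarith [hmin z hz]
    have hE0 : 0 ≤ E := hEdef ▸ Finset.sum_nonneg hnn
    have hEm : E ≤ T + γ := by rw [hEe]; nlinarith
    have hmom' : 2 * γ * (T : ℝ) ^ 2 - 3 * γ ^ 2 * T + γ ^ 3 ≤ T * F := by linarith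
    have hsecond : ∀ c : ℝ, (∀ z ∈ Γ.neighborFinset y, T * (α y * α z - T) ≤ c) →
        T * F ≤ c * E := by
      intro c hc
      rw [← hFdef, ← hEdef, Finset.mul_sum, Finset.mul_sum]
      refine Finset.sum_le_sum fun z hz => ?_
      have := mul_le_mul_of_nonneg_right (hc z hz) (hnn z hz)
      linarith
    have hpair : ∀ c : ℝ, α z₀ * (α x - α z₀) ≤ c → ∀ z ∈ Γ.neighborFinset y,
        T * (α y * α z - T) ≤ γ * c := by
      intro c hc z hz
      have h1 := mul_le_mul_of_nonneg_left hc hg0.le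
      have h2 : γ * (α z₀ * (α x - α z₀)) = (α y * α z₀) * (α y * α x - α y * α z₀) := by
        rw [← hg]; ring
      rw [h2, he₀] at h1
      have h3 := mul_le_mul_of_nonneg_left (hB z) (show (0 : ℝ) ≤ T by linarith)
      linarith
    by_cases h3 : 3 ≤ γ
    · refine endgame_zero (E := E) ht (g := γ) ?_ hE0 hEm ?_
      · interval_cases γ <;> norm_num
      · have h1 := hsecond _ (hpair K (hK z₀))
        have h2 := mul_le_mul_of_nonneg_right hR hE0
        have h4 := mul_le_mul_of_nonneg_left (hmom'.trans h1) (show (0 : ℝ) ≤ T - 1 by linarith)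
        linarith
    · have h1 : ∀ z ∈ Γ.neighborFinset y, α y * α z - T ≤ 2 * γ - 1 := by
        intro z hz
        have h1 := hpair _ (hK2 z₀) z hz
        obtain ⟨k, hk, -⟩ := hZ z hz
        rw [hk] at h1 ⊢
        have h4 : (k : ℝ) < 2 * γ := by
          refine lt_of_mul_lt_mul_left ?_ (show (0 : ℝ) ≤ T by linarith)
          linarith
        have h5 : k < 2 * γ := by exact_mod_cast h4
        have h6 : k ≤ 2 * γ - 1 := by omega
        exact_mod_cast h6
      have h2 := hsecond (T * (2 * γ - 1)) fun z hz =>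
        mul_le_mul_of_nonneg_left (h1 z hz) (by linarith)
      obtain rfl | rfl : γ = 1 ∨ γ = 2 := by omega
      · push_cast at *
        nlinarith
      · push_cast at *
        nlinarith

end SpectralData

/-- For a graph in H′(s,t) with a maximum-degree vertex x and a vertex y with
α_y ≤ α_x − 4 (where α_v = √(d_v − t)), we have t ≤ 29. -/
theorem H'_st_alpha_gap_four_t_le_29
    {V : Type} [Fintype V] [DecidableEq V] (Γ : SimpleGraph V) [DecidableRel Γ.Adj]
    (s t : ℝ)
    (hconn : Γ.Connected)
    (hnonreg : ¬ ∃ k, Γ.IsRegularOfDegree k)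
    (hs : 1 < s) (ht : -t < 1)
    (hspec : spectrum ℝ (Γ.adjMatrix ℝ) = {s, 1, -t})
    (hnotcone : ¬ ∃ v : V, Γ.degree v = Fintype.card V - 1)
    (hnotbireg : ((Finset.univ : Finset V).image (fun v => Γ.degree v)).card ≠ 2)
    (x y : V) (hx : Γ.degree x = Γ.maxDegree)
    (hy : Real.sqrt ((Γ.degree y : ℝ) - t) ≤ Real.sqrt ((Γ.degree x : ℝ) - t) - 4) :
    t ≤ 29 := by
  by_contra! ht29
  obtain ⟨α, h⟩ := exists_spectralData Γ hconn hs (by linarith) hspec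
  have hα : ∀ v, √((Γ.degree v : ℝ) - t) = α v := fun v => by
    rw [← h.sq, Real.sqrt_sq (h.pos v).le]
  rw [hα, hα] at hy
  have hxmax : ∀ v, α v ≤ α x := fun v => by
    rw [← hα, ← hα]
    apply Real.sqrt_le_sqrt
    have : (Γ.degree v : ℝ) ≤ Γ.degree x := by exact_mod_cast hx ▸ Γ.degree_le_maxDegree v
    linarith
  obtain ⟨z, hz⟩ : ∃ z, Γ.Adj y z := by
    rw [← Γ.degree_pos_iff_exists_adj]
    have := h.sq y
    have := sq_pos_of_pos (h.pos y)
    have : (0 : ℝ) < Γ.degree y := by linarith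
    exact_mod_cast this
  have hC := fun u w => h.card_compl_union_le (u := u) (w := w) (by linarith) (by linarith)
  obtain ⟨T, hT⟩ := h.exists_int_eq (by linarith) hnonreg y z hz
  have h30 := h.lt_of_gap ⟨T, hT⟩ hxmax hy ((Nat.cast_nonneg _).trans (hC y z hz)) hC (by
    rw [sub_add_cancel]
    exact mul_div_cancel₀ _ (by linarith))
  rw [hT] at h30 ht29
  have h1 : T < 30 := by exact_mod_cast h30
  have h2 : 29 < T := by exact_mod_cast ht29
  omega
end

section
/- Let Γ be an n-vertex connected nonregular finite simple graph whose adjacency matrix has exactly three distinct eigenvalues s > 1 > −t, which is not a cone and not biregular, and suppose Γ has at least 5 distinct vertex degrees. Then t ≤ 29. -/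
open Matrix Finset

theorem Matrix.aeval_eq_zero_of_forall_spectrum {V : Type*} [Fintype V] [DecidableEq V]
    {A : Matrix V V ℝ} (hA : A.IsHermitian) (p : Polynomial ℝ)
    (hp : ∀ x ∈ spectrum ℝ A, p.eval x = 0) : Polynomial.aeval A p = 0 := by
  have hA' : IsSelfAdjoint A := hA
  rw [← cfc_polynomial p A hA', cfc_congr (g := fun _ => (0:ℝ)) hp, cfc_const_zero]

theorem SimpleGraph.adjMatrix_isHermitian {V : Type*} (Γ : SimpleGraph V) [DecidableRel Γ.Adj] :
    (Γ.adjMatrix ℝ).IsHermitian := by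
  ext i j
  simp [Γ.adj_comm]

/-- A nonzero eigenvector of a connected graph for a value bounding the spectrum from above has no
zero entries and its entrywise absolute value is again an eigenvector. -/
theorem SimpleGraph.abs_eigenvector_of_le {V : Type*} [Fintype V] [DecidableEq V]
    (Γ : SimpleGraph V) [DecidableRel Γ.Adj]
    {s : ℝ} (hs : ∀ x ∈ spectrum ℝ (Γ.adjMatrix ℝ), x ≤ s) {v : V → ℝ}
    (hv : Γ.adjMatrix ℝ *ᵥ v = s • v) :
    Γ.adjMatrix ℝ *ᵥ (fun x => |v x|) = s • (fun x => |v x|) := by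
  set A := Γ.adjMatrix ℝ with hA
  have hpsd : (algebraMap ℝ (Matrix V V ℝ) s - A).PosSemidef := by
    rw [Matrix.posSemidef_iff_isHermitian_and_spectrum_nonneg]
    refine ⟨?_, ?_⟩
    · refine Matrix.IsHermitian.sub ?_ Γ.adjMatrix_isHermitian
      rw [Matrix.algebraMap_eq_diagonal]
      exact Matrix.isHermitian_diagonal _
    · intro r hr
      rw [← spectrum.singleton_sub_eq] at hr
      obtain ⟨x, hx, y, hy, rfl⟩ := hr
      simp only [Set.mem_singleton_iff] at hx
      have := hs y hy
      simp only [Set.mem_ofPred_eq]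
      linarith
  have hmul : ∀ w : V → ℝ, (algebraMap ℝ (Matrix V V ℝ) s - A) *ᵥ w = s • w - A *ᵥ w := by
    intro w
    rw [Matrix.sub_mulVec, Algebra.algebraMap_eq_smul_one, Matrix.smul_mulVec, Matrix.one_mulVec]
  set w : V → ℝ := fun x => |v x| with hw
  have h1 : v ⬝ᵥ (A *ᵥ v) ≤ w ⬝ᵥ (A *ᵥ w) := by
    simp only [dotProduct, mulVec, Finset.mul_sum]
    refine Finset.sum_le_sum fun x _ => Finset.sum_le_sum fun y _ => ?_
    simp only [hw, hA, SimpleGraph.adjMatrix_apply]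
    split_ifs
    · simp only [one_mul]
      rw [← abs_mul]
      exact le_abs_self _
    · simp
  have h2 : w ⬝ᵥ w = v ⬝ᵥ v := by
    simp [dotProduct, hw]
  have h3 := hpsd.dotProduct_mulVec_nonneg w
  have h4 : w ⬝ᵥ ((algebraMap ℝ (Matrix V V ℝ) s - A) *ᵥ w) = 0 := by
    simp only [star_trivial] at h3
    refine le_antisymm ?_ h3
    rw [hmul, dotProduct_sub, dotProduct_smul, h2]
    rw [hv, dotProduct_smul] at h1
    linarith
  have h5 := (hpsd.dotProduct_mulVec_zero_iff w).1 (by simpa using h4)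
  rw [hmul] at h5
  exact (sub_eq_zero.1 h5).symm

theorem SimpleGraph.eigenvector_ne_zero {V : Type*} [Fintype V] [DecidableEq V]
    (Γ : SimpleGraph V) [DecidableRel Γ.Adj]
    (hconn : Γ.Connected)
    {s : ℝ} (hs : ∀ x ∈ spectrum ℝ (Γ.adjMatrix ℝ), x ≤ s) {v : V → ℝ}
    (hv : Γ.adjMatrix ℝ *ᵥ v = s • v) {x : V} (hx : v x = 0) : v = 0 := by
  have h := Γ.abs_eigenvector_of_le hs hv
  have key : ∀ a b, Γ.Adj a b → v a = 0 → v b = 0 := by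
    intro a b hab ha
    have h1 := congrFun h a
    rw [SimpleGraph.adjMatrix_mulVec_apply] at h1
    simp only [Pi.smul_apply, ha, abs_zero, smul_eq_mul, mul_zero] at h1
    rw [Finset.sum_eq_zero_iff_of_nonneg (fun _ _ => abs_nonneg _)] at h1
    exact abs_eq_zero.1 (h1 b (by simpa using hab))
  ext y
  obtain ⟨p⟩ := hconn.preconnected x y
  induction p with
  | nil => exact hx
  | cons hab _ ih => exact ih (key _ _ hab hx)

theorem SimpleGraph.exists_perron_vector {V : Type*} [Fintype V] [DecidableEq V]
    (Γ : SimpleGraph V) [DecidableRel Γ.Adj]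
    (hconn : Γ.Connected) {s t : ℝ} (hs : 1 < s) (ht : -t < 1)
    (hspec : spectrum ℝ (Γ.adjMatrix ℝ) = {s, 1, -t}) :
    ∃ α : V → ℝ, (∀ x, 0 < α x) ∧ Γ.adjMatrix ℝ *ᵥ α = s • α ∧
      Γ.adjMatrix ℝ * Γ.adjMatrix ℝ + (t - 1) • Γ.adjMatrix ℝ - t • (1 : Matrix V V ℝ) =
        vecMulVec α α := by
  have hA := Γ.adjMatrix_isHermitian
  set A := Γ.adjMatrix ℝ with hAdef
  have hle : ∀ x ∈ spectrum ℝ A, x ≤ s := by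
    rw [hspec]
    rintro x (rfl | rfl | rfl)
    · rfl
    · exact hs.le
    · linarith
  have hcubic := Matrix.aeval_eq_zero_of_forall_spectrum hA
    ((Polynomial.X - Polynomial.C s) * ((Polynomial.X - Polynomial.C 1) *
      (Polynomial.X + Polynomial.C t))) (by
      rw [hspec]
      rintro x (rfl | rfl | rfl) <;> simp)
  set N := A * A + (t - 1) • A - t • (1 : Matrix V V ℝ) with hN
  have hAN : A * N = s • N := by
    have e : Polynomial.aeval A ((Polynomial.X - Polynomial.C s) * ((Polynomial.X - Polynomial.C 1) *
      (Polynomial.X + Polynomial.C t))) = A * N - s • N := by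
      simp only [map_mul, map_sub, map_add, Polynomial.aeval_X, Polynomial.aeval_C,
        Algebra.algebraMap_eq_smul_one, hN]
      simp only [sub_mul, mul_sub, mul_add, smul_mul_assoc, mul_smul_comm, one_mul,
        mul_one, smul_sub, smul_add, smul_smul]
      module
    rw [hcubic] at e
    exact (sub_eq_zero.1 e.symm)
  have hcol : ∀ y, A *ᵥ (fun x => N x y) = s • (fun x => N x y) := by
    intro y
    ext x
    exact congrFun (congrFun hAN x) y
  have hNsymm : ∀ x y, N x y = N y x := by
    intro x y
    have hT : Nᵀ = N := by
      simp [hN, Matrix.transpose_mul, hAdef]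
    exact congrFun (congrFun hT y) x
  obtain ⟨v, hv0, hv⟩ : ∃ v : V → ℝ, v ≠ 0 ∧ A *ᵥ v = s • v := by
    have : s ∈ spectrum ℝ A := by simp [hspec]
    rw [← Matrix.spectrum_toLin', ← Module.End.hasEigenvalue_iff_mem_spectrum] at this
    obtain ⟨v, hv⟩ := this.exists_hasEigenvector
    exact ⟨v, hv.2, by simpa using hv.apply_eq_smul⟩
  set w : V → ℝ := fun x => |v x| with hw
  have hwA : A *ᵥ w = s • w := Γ.abs_eigenvector_of_le hle hv
  have hwpos : ∀ x, 0 < w x := fun x =>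
    abs_pos.2 fun h => hv0 (Γ.eigenvector_ne_zero hconn hle hv h)
  obtain ⟨x0⟩ := hconn.nonempty
  have hprop : ∀ u : V → ℝ, A *ᵥ u = s • u → ∀ x, w x0 * u x = u x0 * w x := by
    intro u hu x
    have h := Γ.eigenvector_ne_zero hconn hle (v := w x0 • u - u x0 • w) (x := x0) (by
      rw [← hAdef, Matrix.mulVec_sub, Matrix.mulVec_smul, Matrix.mulVec_smul, hu, hwA]
      module) (by simp [mul_comm])
    have := congrFun h x
    simpa [sub_eq_zero] using this
  have hNc : ∀ x y, N x y = N x0 x0 / (w x0)^2 * (w x * w y) := by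
    intro x y
    have h1 := hprop _ (hcol y) x
    have h2 := hprop _ (hcol x0) y
    rw [hNsymm x0 y] at h1
    have := (hwpos x0).ne'
    field_simp
    linear_combination w x0 * h1 + w x * h2
  have hNw : N *ᵥ w = ((s - 1) * (s + t)) • w := by
    rw [hN, Matrix.sub_mulVec, Matrix.add_mulVec, ← Matrix.mulVec_mulVec, Matrix.smul_mulVec,
      Matrix.smul_mulVec, Matrix.one_mulVec, hwA, Matrix.mulVec_smul, hwA]
    module
  have hcpos : 0 < N x0 x0 / (w x0)^2 := by
    have h := congrFun hNw x0
    simp only [mulVec, dotProduct, Pi.smul_apply, smul_eq_mul] at h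
    have h' : N x0 x0 / (w x0)^2 * ∑ y, (w y)^2 = (s - 1) * (s + t) := by
      have hx := (hwpos x0).ne'
      rw [← mul_left_inj' hx, ← h, Finset.mul_sum, Finset.sum_mul]
      refine Finset.sum_congr rfl fun y _ => ?_
      rw [hNc x0 y]
      ring
    have : 0 < (s - 1) * (s + t) := mul_pos (by linarith) (by linarith)
    rw [← h'] at this
    exact pos_of_mul_pos_left this (Finset.sum_nonneg fun _ _ => sq_nonneg _)
  refine ⟨Real.sqrt (N x0 x0 / (w x0)^2) • w, fun x => ?_, ?_, ?_⟩
  · exact mul_pos (Real.sqrt_pos.2 hcpos) (hwpos x)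
  · rw [Matrix.mulVec_smul, hwA, smul_comm]
  · ext x y
    rw [vecMulVec_apply, hNc x y]
    simp only [Pi.smul_apply, smul_eq_mul]
    linear_combination (-(w x * w y)) * Real.mul_self_sqrt hcpos.le

theorem Matrix.rank_hadamard_self_le {V : Type*} [Fintype V] [DecidableEq V] (B : Matrix V V ℝ) :
    (B ⊙ B).rank ≤ (B.rank + 1).choose 2 := by
  classical
  set W := Submodule.span ℝ (Set.range B.col) with hW
  have hr : B.rank = Module.finrank ℝ W := B.rank_eq_finrank_span_cols
  let b := Module.finBasis ℝ W
  let q : Sym2 (Fin (Module.finrank ℝ W)) → (V → ℝ) :=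
    Sym2.lift ⟨fun i j => (b i : V → ℝ) * (b j : V → ℝ), fun i j => mul_comm _ _⟩
  have hcol : Submodule.span ℝ (Set.range (B ⊙ B).col) ≤ Submodule.span ℝ (Set.range q) := by
    rw [Submodule.span_le]
    rintro _ ⟨y, rfl⟩
    have hy : B.col y ∈ W := Submodule.subset_span ⟨y, rfl⟩
    have hrep : B.col y = ∑ i, b.repr ⟨B.col y, hy⟩ i • (b i : V → ℝ) := by
      have := congrArg Subtype.val (b.sum_repr ⟨B.col y, hy⟩)
      simp only [Submodule.coe_sum, Submodule.coe_smul] at this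
      exact this.symm
    have hsq : (B ⊙ B).col y = B.col y * B.col y := by
      ext x
      simp [Matrix.col]
    rw [hsq, hrep, Finset.sum_mul_sum]
    refine Submodule.sum_mem _ fun i _ => Submodule.sum_mem _ fun j _ => ?_
    rw [smul_mul_smul_comm]
    exact Submodule.smul_mem _ _ (Submodule.subset_span ⟨s(i, j), rfl⟩)
  calc (B ⊙ B).rank = Module.finrank ℝ (Submodule.span ℝ (Set.range (B ⊙ B).col)) :=
        (B ⊙ B).rank_eq_finrank_span_cols
    _ ≤ Module.finrank ℝ (Submodule.span ℝ (Set.range q)) := Submodule.finrank_mono hcol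
    _ ≤ Fintype.card (Sym2 (Fin (Module.finrank ℝ W))) := finrank_range_le_card q
    _ = (B.rank + 1).choose 2 := by rw [Sym2.card, Fintype.card_fin, hr]

theorem Matrix.rank_add_le' {V : Type*} [Fintype V] (B C : Matrix V V ℝ) :
    (B + C).rank ≤ B.rank + C.rank := by
  rw [Matrix.rank, Matrix.rank, Matrix.rank, Matrix.mulVecLin_add]
  refine (Submodule.finrank_mono (?_ : _ ≤ LinearMap.range B.mulVecLin ⊔
    LinearMap.range C.mulVecLin)).trans (Submodule.finrank_add_le_finrank_add_finrank _ _)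
  rintro _ ⟨x, rfl⟩
  exact Submodule.add_mem_sup ⟨x, rfl⟩ ⟨x, rfl⟩

theorem Matrix.trace_eq_rank_mul_of_mul_self {V : Type*} [Fintype V] [DecidableEq V]
    {G : Matrix V V ℝ} {c : ℝ} (hc : c ≠ 0) (hG : G * G = c • G) :
    G.trace = G.rank * c := by
  have hid : IsIdempotentElem (Matrix.toLin' (c⁻¹ • G)) := by
    rw [IsIdempotentElem, Module.End.mul_eq_comp, ← Matrix.toLin'_mul, smul_mul_smul_comm, hG,
      smul_smul, inv_mul_cancel_right₀ hc]
  have h := ((LinearMap.isProj_range_iff_isIdempotentElem _).2 hid).trace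
  rw [Matrix.trace_toLin'_eq, Matrix.trace_smul, smul_eq_mul] at h
  have hr : Module.finrank ℝ (LinearMap.range (Matrix.toLin' (c⁻¹ • G))) = G.rank := by
    have h1 : (c⁻¹ • G).rank = G.rank :=
      Matrix.rank_smul_of_mem_nonZeroDivisors G
        (mem_nonZeroDivisors_of_ne_zero (inv_ne_zero hc))
    rw [← h1, Matrix.rank, Matrix.toLin'_apply']
  rw [hr] at h
  rw [← h]
  field_simp

theorem SimpleGraph.isUnit_one_add_adjMatrix {V : Type*} [Fintype V] [DecidableEq V]
    (Γ : SimpleGraph V) [DecidableRel Γ.Adj] (h : (-1 : ℝ) ∉ spectrum ℝ (Γ.adjMatrix ℝ)) :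
    IsUnit (1 + Γ.adjMatrix ℝ) := by
  rw [spectrum.notMem_iff] at h
  have e : algebraMap ℝ (Matrix V V ℝ) (-1) - Γ.adjMatrix ℝ = -(1 + Γ.adjMatrix ℝ) := by
    rw [map_neg, map_one]; abel
  rw [e, IsUnit.neg_iff] at h
  exact h

theorem SimpleGraph.exists_rank_bounds {V : Type*} [Fintype V] [DecidableEq V]
    (Γ : SimpleGraph V) [DecidableRel Γ.Adj] {s t : ℝ} {α : V → ℝ} (hst : 0 < s + t)
    (ht : 1 < t)
    (hs : 1 < s) (hspec : spectrum ℝ (Γ.adjMatrix ℝ) = {s, 1, -t})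
    (hα : Γ.adjMatrix ℝ *ᵥ α = s • α) (hsum : ∑ x, α x ^ 2 = (s - 1) * (s + t))
    (hN : Γ.adjMatrix ℝ * Γ.adjMatrix ℝ + (t - 1) • Γ.adjMatrix ℝ - t • (1 : Matrix V V ℝ) =
        vecMulVec α α) :
    ∃ m : ℕ, m * (t + 1) = Fintype.card V + s - 1 ∧
      2 * Fintype.card V ≤ (m + 1) * (m + 2) ∧
      ∀ S : Finset V, (∀ x ∈ S, ∀ y ∈ S, ¬ Γ.Adj x y) → S.card ≤ m := by
  set A := Γ.adjMatrix ℝ with hA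
  set c := (s + t)⁻¹ with hc
  have hcst : c * (s + t) = 1 := inv_mul_cancel₀ hst.ne'
  set G : Matrix V V ℝ := 1 - A + c • vecMulVec α α with hG
  have hvA : vecMulVec α α * A = s • vecMulVec α α := by
    have : vecMul α A = s • α := by
      rw [← hα, ← Matrix.vecMul_transpose, hA, SimpleGraph.transpose_adjMatrix]
    rw [Matrix.vecMulVec_mul, this, Matrix.vecMulVec_smul]
  have hAv : A * vecMulVec α α = s • vecMulVec α α := by
    rw [Matrix.mul_vecMulVec, hα, Matrix.smul_vecMulVec]
  have hdot : α ⬝ᵥ α = (s - 1) * (s + t) := by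
    rw [← hsum]; simp [dotProduct, sq]
  have hvv : vecMulVec α α * vecMulVec α α = ((s - 1) * (s + t)) • vecMulVec α α := by
    rw [Matrix.vecMulVec_mul_vecMulVec, hdot, Matrix.vecMulVec_smul]
  have hAA : A * A = vecMulVec α α - (t - 1) • A + t • (1 : Matrix V V ℝ) := by
    rw [← hN]; abel
  have hGG : G * G = (t + 1) • G := by
    simp only [hG, mul_add, add_mul, sub_mul, mul_sub, one_mul, mul_one, hAA, smul_mul_assoc,
      mul_smul_comm, hAv, hvA, hvv, smul_smul]
    ext x y
    simp only [Matrix.add_apply, Matrix.sub_apply, Matrix.smul_apply, smul_eq_mul]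
    linear_combination (vecMulVec α α x y) * ((s - 1) * c - 1) * hcst
  have htr : G.trace = Fintype.card V + s - 1 := by
    rw [hG, Matrix.trace_add, Matrix.trace_sub, Matrix.trace_one, hA,
      SimpleGraph.trace_adjMatrix, Matrix.trace_smul, Matrix.trace_vecMulVec, hdot, smul_eq_mul]
    linear_combination (s - 1) * hcst
  refine ⟨G.rank, ?_, ?_, ?_⟩
  · rw [← htr, Matrix.trace_eq_rank_mul_of_mul_self (by linarith) hGG]
  · have h1 : (1 - A).rank ≤ G.rank + 1 := by
      have e : 1 - A = G + (-vecMulVec (c • α) α) := by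
        rw [hG, Matrix.smul_vecMulVec]; abel
      rw [e, ← Matrix.neg_vecMulVec]
      exact (Matrix.rank_add_le' _ _).trans (Nat.add_le_add_left (Matrix.rank_vecMulVec_le _ _) _)
    have h2 : (1 - A) ⊙ (1 - A) = 1 + A := by
      ext x y
      simp only [hadamard_apply, Matrix.sub_apply, Matrix.add_apply, hA, SimpleGraph.adjMatrix_apply,
        Matrix.one_apply]
      by_cases hxy : x = y
      · subst hxy; simp
      · by_cases h : Γ.Adj x y <;> simp [hxy, h]
    have h3 : (1 + A).rank = Fintype.card V := by
      refine Matrix.rank_of_isUnit _ (Γ.isUnit_one_add_adjMatrix ?_)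
      rw [hspec]
      simp only [Set.mem_insert_iff, Set.mem_singleton_iff, not_or]
      refine ⟨?_, ?_, ?_⟩ <;> intro h <;> linarith
    have h4 := Matrix.rank_hadamard_self_le (1 - A)
    rw [h2, h3] at h4
    have h5 := h4.trans (Nat.choose_le_choose 2 (Nat.add_le_add_right h1 1))
    rw [Nat.choose_two_right] at h5
    have : (G.rank + 1 + 1) * (G.rank + 1 + 1 - 1) = (G.rank + 1) * (G.rank + 2) := by
      rw [Nat.add_sub_cancel]; ring
    rw [this] at h5
    omega
  · intro S hS
    let f : S → V := Subtype.val
    have hsub := G.rank_submatrix_le f f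
    have hpd : (G.submatrix f f).PosDef := by
      have e : G.submatrix f f = 1 + c • vecMulVec (fun x : S => α x) (fun x : S => α x) := by
        ext x y
        simp only [hG, Matrix.submatrix_apply, Matrix.sub_apply, Matrix.add_apply, hA,
          SimpleGraph.adjMatrix_apply, Matrix.one_apply, Matrix.smul_apply, vecMulVec_apply, f]
        rw [if_neg (hS x x.2 y y.2)]
        simp only [sub_zero, smul_eq_mul, SetCoe.ext_iff]
      rw [e]
      refine Matrix.PosDef.one.add_posSemidef (Matrix.PosSemidef.smul ?_ (inv_nonneg.2 hst.le))
      simpa using Matrix.posSemidef_vecMulVec_self_star (fun x : S => α x)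
    rw [Matrix.rank_of_isUnit _ hpd.isUnit, Fintype.card_coe] at hsub
    exact hsub

theorem Rat.exists_int_eq_of_quadratic {q : ℚ} {b c : ℤ} (h : q ^ 2 - b * q + c = 0) :
    ∃ T : ℤ, q = T := by
  have hint : IsIntegral ℤ q := by
    refine ⟨Polynomial.X ^ 2 - Polynomial.C b * Polynomial.X + Polynomial.C c, by monicity!, ?_⟩
    simp only [Polynomial.eval₂_add, Polynomial.eval₂_sub, Polynomial.eval₂_mul,
      Polynomial.eval₂_X_pow, Polynomial.eval₂_C, Polynomial.eval₂_X, algebraMap_int_eq]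
    simpa using h
  obtain ⟨T, hT⟩ := IsIntegrallyClosed.isIntegral_iff.1 hint
  exact ⟨T, by rw [← hT]; simp⟩

/-- A positive weight `α` on the vertices of a graph whose adjacency matrix `A` satisfies `A α = s α`,
`(A - 1) (A + t) = α αᵀ` and `αᵀ α = (s - 1) (s + t)`, written out entrywise. -/
structure SimpleGraph.IsPerronWeight {V : Type*} [Fintype V] [DecidableEq V]
    (Γ : SimpleGraph V) [DecidableRel Γ.Adj] (s t : ℝ) (α : V → ℝ) : Prop where
  pos : ∀ x, 0 < α x
  sum_neighbor : ∀ x, ∑ y ∈ Γ.neighborFinset x, α y = s * α x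
  degree_eq : ∀ x, (Γ.degree x : ℝ) = t + α x ^ 2
  card_common : ∀ x y, x ≠ y →
    ((Γ.neighborFinset x ∩ Γ.neighborFinset y).card : ℝ) =
      α x * α y - if Γ.Adj x y then t - 1 else 0
  sum_sq : ∑ x, α x ^ 2 = (s - 1) * (s + t)

theorem SimpleGraph.exists_isPerronWeight {V : Type*} [Fintype V] [DecidableEq V]
    (Γ : SimpleGraph V) [DecidableRel Γ.Adj]
    (hconn : Γ.Connected) {s t : ℝ} (hs : 1 < s) (ht : 1 < t)
    (hspec : spectrum ℝ (Γ.adjMatrix ℝ) = {s, 1, -t}) :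
    ∃ α : V → ℝ, Γ.IsPerronWeight s t α ∧ ∃ m : ℕ, m * (t + 1) = Fintype.card V + s - 1 ∧
      2 * Fintype.card V ≤ (m + 1) * (m + 2) ∧
      ∀ S : Finset V, (∀ x ∈ S, ∀ y ∈ S, ¬ Γ.Adj x y) → S.card ≤ m := by
  obtain ⟨α, hpos, hα, hN⟩ := Γ.exists_perron_vector hconn hs (by linarith) hspec
  have hentry : ∀ x y, ((Γ.neighborFinset x ∩ Γ.neighborFinset y).card : ℝ) +
      (t - 1) * (if Γ.Adj x y then 1 else 0) - t * (if x = y then 1 else 0) = α x * α y := by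
    intro x y
    have h := congrFun (congrFun hN x) y
    rw [vecMulVec_apply] at h
    rw [← h]
    simp only [Matrix.sub_apply, Matrix.add_apply, Matrix.smul_apply, smul_eq_mul,
      Matrix.one_apply, SimpleGraph.adjMatrix_mul_apply, SimpleGraph.adjMatrix_apply,
      Finset.sum_boole]
    congr 4
    ext z
    simp [Γ.adj_comm]
  have hsum : ∑ x, α x ^ 2 = (s - 1) * (s + t) := by
    obtain ⟨x⟩ := hconn.nonempty
    have h := congrArg (fun M => (M *ᵥ α) x) hN
    simp only [Matrix.sub_mulVec, Matrix.add_mulVec, ← Matrix.mulVec_mulVec, Matrix.smul_mulVec,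
      Matrix.one_mulVec, hα, Matrix.mulVec_smul, Matrix.vecMulVec_mulVec] at h
    simp only [Pi.sub_apply, Pi.add_apply, Pi.smul_apply, smul_eq_mul,
      MulOpposite.smul_eq_mul_unop, MulOpposite.unop_op] at h
    have h2 : α ⬝ᵥ α = ∑ x, α x ^ 2 := by simp [dotProduct, sq]
    rw [h2] at h
    refine mul_left_cancel₀ (hpos x).ne' ?_
    linear_combination -h
  refine ⟨α, ⟨hpos, fun x => ?_, fun x => ?_, fun x y hxy => ?_, hsum⟩,
    Γ.exists_rank_bounds (by linarith) ht hs hspec hα hsum hN⟩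
  · have h := congrFun hα x
    rwa [SimpleGraph.adjMatrix_mulVec_apply] at h
  · have h := hentry x x
    simp only [Finset.inter_self, SimpleGraph.card_neighborFinset_eq_degree, Γ.irrefl, if_true,
      if_false] at h
    linarith
  · have h := hentry x y
    rw [if_neg hxy] at h
    split_ifs at h ⊢ <;> linarith

namespace SimpleGraph.IsPerronWeight

variable {V : Type*} [Fintype V] [DecidableEq V] {Γ : SimpleGraph V} [DecidableRel Γ.Adj]
  {s t : ℝ} {α : V → ℝ}

theorem sub_one_le_mul (h : Γ.IsPerronWeight s t α) {x y : V} (hxy : Γ.Adj x y) :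
    t - 1 ≤ α x * α y := by
  have h1 := h.card_common x y hxy.ne
  rw [if_pos hxy] at h1
  have : (0 : ℝ) ≤ (Γ.neighborFinset x ∩ Γ.neighborFinset y).card := Nat.cast_nonneg _
  linarith

theorem mul_sub_le (h : Γ.IsPerronWeight s t α) (ht : 2 ≤ t) (x y : V) :
    α y * (α x - α y) ≤ 2 * t - 2 := by
  by_cases hxy : x = y
  · subst hxy; nlinarith
  have h1 := h.card_common x y hxy
  have h2 := h.degree_eq y
  by_cases hadj : Γ.Adj x y
  · rw [if_pos hadj] at h1
    have h3 : (Γ.neighborFinset x ∩ Γ.neighborFinset y).card < (Γ.neighborFinset y).card := by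
      refine Finset.card_lt_card ⟨Finset.inter_subset_right, fun hsub => ?_⟩
      have := hsub (by simpa using hadj.symm : x ∈ Γ.neighborFinset y)
      simp at this
    rw [SimpleGraph.card_neighborFinset_eq_degree] at h3
    have h4 : ((Γ.neighborFinset x ∩ Γ.neighborFinset y).card : ℝ) + 1 ≤ Γ.degree y := by
      exact_mod_cast h3
    nlinarith
  · rw [if_neg hadj] at h1
    have h3 : (Γ.neighborFinset x ∩ Γ.neighborFinset y).card ≤ (Γ.neighborFinset y).card :=
      Finset.card_le_card Finset.inter_subset_right
    rw [SimpleGraph.card_neighborFinset_eq_degree] at h3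
    have h4 : ((Γ.neighborFinset x ∩ Γ.neighborFinset y).card : ℝ) ≤ Γ.degree y := by
      exact_mod_cast h3
    nlinarith

theorem sum_cube (h : Γ.IsPerronWeight s t α) : ∑ x, α x ^ 3 = (s - t) * ∑ x, α x := by
  have h1 : ∑ x, ∑ y ∈ Γ.neighborFinset x, α y = ∑ y, (Γ.degree y : ℝ) * α y := by
    have e : ∀ x, ∑ y ∈ Γ.neighborFinset x, α y = ∑ y, if Γ.Adj x y then α y else 0 := by
      intro x
      rw [← Finset.sum_filter]
      refine Finset.sum_congr ?_ fun _ _ => rfl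
      ext; simp
    rw [Finset.sum_congr rfl fun x _ => e x, Finset.sum_comm]
    refine Finset.sum_congr rfl fun y _ => ?_
    rw [← Finset.sum_filter, Finset.sum_const, nsmul_eq_mul,
      ← SimpleGraph.card_neighborFinset_eq_degree]
    congr 3
    ext; simp [Γ.adj_comm]
  rw [Finset.sum_congr rfl fun x _ => h.sum_neighbor x, ← Finset.mul_sum] at h1
  have h2 : ∑ y, (Γ.degree y : ℝ) * α y = t * ∑ y, α y + ∑ y, α y ^ 3 := by
    rw [Finset.mul_sum, ← Finset.sum_add_distrib]
    refine Finset.sum_congr rfl fun y _ => ?_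
    rw [h.degree_eq y]; ring
  linarith

theorem mul_le_of_le (h : Γ.IsPerronWeight s t α) {b : ℝ} (hb : ∀ y, α y ≤ b) (x : V) :
    s * α x ≤ b * (t + α x ^ 2) := by
  rw [← h.sum_neighbor x, ← h.degree_eq x, ← SimpleGraph.card_neighborFinset_eq_degree, mul_comm,
    ← nsmul_eq_mul]
  exact Finset.sum_le_card_nsmul _ _ _ fun y _ => hb y

theorem le_mul_of_le (h : Γ.IsPerronWeight s t α) {a : ℝ} {x : V} (ha : ∀ y, Γ.Adj x y → a ≤ α y) :
    a * (t + α x ^ 2) ≤ s * α x := by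
  rw [← h.sum_neighbor x, ← h.degree_eq x, ← SimpleGraph.card_neighborFinset_eq_degree, mul_comm,
    ← nsmul_eq_mul]
  exact Finset.card_nsmul_le_sum _ _ _ fun y hy => ha y (by simpa using hy)

theorem exists_int_mul_eq (h : Γ.IsPerronWeight s t α) {T : ℤ} (hT : t = T) (x y : V) :
    ∃ k : ℤ, α x * α y = k := by
  by_cases hxy : x = y
  · refine ⟨Γ.degree x - T, ?_⟩
    have := h.degree_eq x
    subst hxy
    push_cast
    rw [← hT]; linarith
  · have := h.card_common x y hxy
    by_cases hadj : Γ.Adj x y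
    · refine ⟨(Γ.neighborFinset x ∩ Γ.neighborFinset y).card + T - 1, ?_⟩
      rw [if_pos hadj] at this
      push_cast
      rw [← hT]; linarith
    · refine ⟨(Γ.neighborFinset x ∩ Γ.neighborFinset y).card, ?_⟩
      rw [if_neg hadj] at this
      push_cast
      linarith

theorem add_one_le_of_lt (h : Γ.IsPerronWeight s t α) {T : ℤ} (hT : t = T) {x y : V}
    (hxy : α x < α y) : α x + 1 ≤ α y := by
  obtain ⟨k1, h1⟩ := h.exists_int_mul_eq hT x x
  obtain ⟨k2, h2⟩ := h.exists_int_mul_eq hT x y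
  obtain ⟨k3, h3⟩ := h.exists_int_mul_eq hT y y
  have h4 : (α y - α x) ^ 2 = ((k3 - 2 * k2 + k1 : ℤ) : ℝ) := by
    push_cast; linear_combination h1 - 2 * h2 + h3
  have h5 : (0 : ℝ) < ((k3 - 2 * k2 + k1 : ℤ) : ℝ) := by
    rw [← h4]; exact pow_pos (sub_pos.2 hxy) 2
  have h6 : (1 : ℝ) ≤ ((k3 - 2 * k2 + k1 : ℤ) : ℝ) := by
    exact_mod_cast Int.cast_pos.1 h5
  nlinarith

theorem lt_of_degree_lt (h : Γ.IsPerronWeight s t α) {x y : V}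
    (hxy : Γ.degree x < Γ.degree y) : α x < α y := by
  have h1 : (Γ.degree x : ℝ) < Γ.degree y := by exact_mod_cast hxy
  rw [h.degree_eq, h.degree_eq] at h1
  exact lt_of_pow_lt_pow_left₀ 2 (h.pos y).le (by linarith)

theorem exists_rat_sub (h : Γ.IsPerronWeight s t α) {x y : V} (hxy : x ≠ y)
    (hadj : ¬ Γ.Adj x y) : ∃ q : ℚ, s - t = q := by
  have h1 : ∀ z ∈ Γ.neighborFinset x, α z * α y =
      ((Γ.neighborFinset z ∩ Γ.neighborFinset y).card : ℝ) + (if Γ.Adj z y then t - 1 else 0) := by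
    intro z hz
    have hzy : z ≠ y := by
      rintro rfl
      exact hadj (by simpa using hz)
    rw [h.card_common z y hzy]
    ring
  have h2 := Finset.sum_congr rfl h1
  rw [← Finset.sum_mul, h.sum_neighbor, Finset.sum_add_distrib, ← Finset.sum_filter,
    Finset.sum_const, nsmul_eq_mul, ← Nat.cast_sum] at h2
  have h3 : (Γ.neighborFinset x).filter (fun z => Γ.Adj z y) =
      Γ.neighborFinset x ∩ Γ.neighborFinset y := by
    ext z; simp [Γ.adj_comm y z]
  rw [h3] at h2
  have h4 := h.card_common x y hxy
  rw [if_neg hadj, sub_zero] at h4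
  have hpos : 0 < α x * α y := mul_pos (h.pos x) (h.pos y)
  rw [← h4] at hpos
  generalize (∑ z ∈ Γ.neighborFinset x, (Γ.neighborFinset z ∩ Γ.neighborFinset y).card) = K at h2
  generalize (Γ.neighborFinset x ∩ Γ.neighborFinset y).card = ν at h2 h4 hpos
  refine ⟨K / ν - 1, ?_⟩
  push_cast
  field_simp
  rw [mul_assoc, ← h4] at h2
  linear_combination h2

theorem exists_int_eq (h : Γ.IsPerronWeight s t α) {x y : V} (hxy : x ≠ y)
    (hadj : ¬ Γ.Adj x y) (htq : ∃ q : ℚ, t = q) : ∃ T : ℤ, t = T := by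
  obtain ⟨q, hq⟩ := htq
  have h4 := h.card_common x y hxy
  rw [if_neg hadj, sub_zero] at h4
  have hx := h.degree_eq x
  have hy := h.degree_eq y
  generalize (Γ.neighborFinset x ∩ Γ.neighborFinset y).card = ν at h4
  have hquad : (q : ℝ) ^ 2 - (Γ.degree x + Γ.degree y) * q + (Γ.degree x * Γ.degree y - ν ^ 2) = 0 := by
    rw [← hq, h4, hx, hy]; ring
  have hquad' : q ^ 2 - (Γ.degree x + Γ.degree y) * q + (Γ.degree x * Γ.degree y - ν ^ 2) = 0 := by
    exact_mod_cast hquad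
  obtain ⟨T, hT⟩ := Rat.exists_int_eq_of_quadratic
    (b := Γ.degree x + Γ.degree y) (c := Γ.degree x * Γ.degree y - ν ^ 2)
    (by push_cast; exact hquad')
  exact ⟨T, by rw [hq, hT]; simp⟩

end SimpleGraph.IsPerronWeight

namespace SimpleGraph.IsPerronWeight

variable {V : Type*} [Fintype V] [DecidableEq V] {Γ : SimpleGraph V} [DecidableRel Γ.Adj]
  {s t : ℝ} {α : V → ℝ}

theorem exists_int_eq_of_rank (h : Γ.IsPerronWeight s t α) {m : ℕ} (ht : 1 < t)
    (hm : m * (t + 1) = Fintype.card V + s - 1) {x y : V} (hxy : x ≠ y)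
    (hadj : ¬ Γ.Adj x y) : ∃ T : ℤ, t = T := by
  refine h.exists_int_eq hxy hadj ?_
  have hn : (2 : ℝ) ≤ Fintype.card V := by
    have : 1 < Fintype.card V := Fintype.one_lt_card_iff.2 ⟨x, y, hxy⟩
    exact_mod_cast this
  have hst : t < s := by
    obtain ⟨u, -, hu⟩ := Finset.exists_min_image Finset.univ α ⟨x, Finset.mem_univ x⟩
    have h1 := h.le_mul_of_le (x := u) fun y _ => hu y (Finset.mem_univ y)
    have h2 := h.pos u
    rw [mul_comm] at h1
    have := le_of_mul_le_mul_right h1 h2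
    have := pow_pos h2 2
    linarith
  have hm2 : 2 ≤ m := by
    by_contra! hlt
    interval_cases m
    · norm_num at hm; linarith
    · norm_num at hm; linarith
  obtain ⟨q, hq⟩ := h.exists_rat_sub hxy hadj
  refine ⟨(Fintype.card V + q - 1 - m) / (m - 1), ?_⟩
  have hm1 : (m : ℝ) - 1 ≠ 0 := by
    have : (2 : ℝ) ≤ m := by exact_mod_cast hm2
    linarith
  push_cast
  rw [← hq, eq_div_iff hm1]
  linarith

theorem exists_int_mul_min_eq (h : Γ.IsPerronWeight s t α) {T : ℤ} (hT : t = T) {u : V}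
    (hu : α u ^ 2 < 4) (x : V) : ∃ c : ℤ, α x = c * α u := by
  obtain ⟨k, hk⟩ := h.exists_int_mul_eq hT u u
  obtain ⟨p, hp⟩ := h.exists_int_mul_eq hT x u
  obtain ⟨r, hr⟩ := h.exists_int_mul_eq hT x x
  have hupos := h.pos u
  have hk4 : k < 4 := by
    have : (k : ℝ) < 4 := by rw [← hk, ← sq]; exact hu
    exact_mod_cast this
  have hk0 : 0 < k := by
    have : (0 : ℝ) < k := by rw [← hk]; positivity
    exact_mod_cast this
  have hpk : p ^ 2 = k * r := by
    have : (p : ℝ) ^ 2 = k * r := by rw [← hp, ← hk, ← hr]; ring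
    exact_mod_cast this
  have hdvd : k ∣ p := by
    have h1 : k ∣ p ^ 2 := ⟨r, hpk⟩
    interval_cases k
    · exact one_dvd p
    · exact Int.prime_two.dvd_of_dvd_pow h1
    · exact Int.prime_three.dvd_of_dvd_pow h1
  obtain ⟨c, hc⟩ := hdvd
  refine ⟨c, mul_right_cancel₀ hupos.ne' ?_⟩
  rw [hp, hc, mul_assoc, hk]
  push_cast; ring

theorem four_le_sq (h : Γ.IsPerronWeight s t α) {T : ℤ} (hT : t = T) (ht : 30 ≤ t)
    {u z : V} (hu : ∀ x, α u ≤ α x) (hz : ∀ x, α x ≤ α z)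
    {v : Fin 5 → V} (hv : ∀ i j, i < j → α (v i) < α (v j)) (hadj : ∃ y, Γ.Adj u y) :
    4 ≤ α u ^ 2 := by
  by_contra! hlt
  have ha := h.pos u
  choose c hc using h.exists_int_mul_min_eq hT hlt
  have hmono : ∀ x y, α x < α y → c x + 1 ≤ c y := by
    intro x y hxy
    rw [hc x, hc y] at hxy
    have := lt_of_mul_lt_mul_right hxy ha.le
    exact_mod_cast this
  have hmono' : ∀ x y, α x ≤ α y → c x ≤ c y := by
    intro x y hxy
    rw [hc x, hc y] at hxy
    have := le_of_mul_le_mul_right hxy ha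
    exact_mod_cast this
  have hcu : c u = 1 := by
    have h1 := hc u
    have : (c u : ℝ) = 1 := by
      have : ((c u : ℝ) - 1) * α u = 0 := by linarith
      rcases mul_eq_zero.1 this with h | h <;> linarith
    exact_mod_cast this
  have h0 := hmono' u (v 0) (hu _)
  have h1 := hmono _ _ (hv 0 1 (by decide))
  have h2 := hmono _ _ (hv 1 2 (by decide))
  have h3 := hmono _ _ (hv 2 3 (by decide))
  have h4 := hmono _ _ (hv 3 4 (by decide))
  have h5 := hmono' _ z (hz (v 4))
  obtain ⟨k, hk⟩ := h.exists_int_mul_eq hT u u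
  have hk4 : k ≤ 3 := by
    have : (k : ℝ) < 4 := by rw [← hk, ← sq]; exact hlt
    have : k < 4 := by exact_mod_cast this
    omega
  have hk0 : 1 ≤ k := by
    have : (0 : ℝ) < k := by rw [← hk]; positivity
    have : 0 < k := by exact_mod_cast this
    omega
  have hT30 : 30 ≤ T := by rw [hT] at ht; exact_mod_cast ht
  have hpair : c (v 1) * (c z - c (v 1)) * k ≤ 2 * T - 2 := by
    have := h.mul_sub_le (by linarith) z (v 1)
    rw [hc z, hc (v 1), hT] at this
    have e : (c (v 1) : ℝ) * (c z - c (v 1)) * k ≤ 2 * T - 2 := by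
      rw [← hk]; linarith
    exact_mod_cast e
  have hnb : ∀ y, Γ.Adj u y → (t - 1) / α u ≤ α y := by
    intro y hy
    rw [div_le_iff₀ ha, mul_comm]
    exact h.sub_one_le_mul hy
  have hlow : T - 1 ≤ c z * k := by
    obtain ⟨y, hy⟩ := hadj
    have h6 := (hnb y hy).trans (hz y)
    rw [div_le_iff₀ ha, hc z, mul_assoc, hk, hT] at h6
    exact_mod_cast h6
  have hsk : (T + k) * (T - 1) ≤ s * k := by
    have h6 := h.le_mul_of_le hnb
    rw [div_mul_eq_mul_div, div_le_iff₀ ha, mul_assoc s, hk, sq, hk, hT] at h6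
    linarith
  have hc2 : c (v 1) = 2 := by
    have h6 : c (v 1) * (c z - c (v 1)) ≤ 2 * c z := by
      have : (c (v 1) * (c z - c (v 1))) * k ≤ (2 * c z) * k := by linarith
      exact le_of_mul_le_mul_right this (by omega)
    have h7 : 10 ≤ c z := by
      by_contra! h8
      have : c z * k ≤ 9 * 3 := mul_le_mul (by omega) hk4 (by omega) (by norm_num)
      omega
    by_contra! hne
    obtain ⟨d, hd⟩ : ∃ d, c z = c (v 1) + d := ⟨c z - c (v 1), by ring⟩
    have hc3 : 3 ≤ c (v 1) := by omega
    have hd3 : 3 ≤ d := by omega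
    rw [hd] at h6 h7
    have h9 : (c (v 1) - 2) * (d - 2) ≤ 4 := by
      have : c (v 1) + d - c (v 1) = d := by ring
      rw [this] at h6; linarith
    generalize c (v 1) = w at *
    have : w ≤ 6 := by nlinarith
    have : d ≤ 6 := by nlinarith
    interval_cases w <;> omega
  rw [hc2] at hpair
  have hup := h.mul_le_of_le hz (v 1)
  rw [hc (v 1), hc z, hc2, hT] at hup
  have hup' : s * 2 ≤ c z * (T + 4 * k) := by
    refine le_of_mul_le_mul_right ?_ ha
    rw [← hk]
    push_cast at hup
    linarith
  have hpair' : (c z : ℝ) * k ≤ T - 1 + 2 * k := by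
    have : c z * k ≤ T - 1 + 2 * k := by linarith
    exact_mod_cast this
  have hfin : (2 * ((T + k) * (T - 1)) : ℝ) ≤ (T - 1 + 2 * k) * (T + 4 * k) := by
    have hkR : (0 : ℝ) < k := by exact_mod_cast (by omega : 0 < k)
    have hTR : (0 : ℝ) < T := by exact_mod_cast (by omega : 0 < T)
    have e1 := mul_le_mul_of_nonneg_right hup' hkR.le
    have e2 := mul_le_mul_of_nonneg_right hpair' (by positivity : (0 : ℝ) ≤ T + 4 * k)
    linarith
  have hfin' : 2 * ((T + k) * (T - 1)) ≤ (T - 1 + 2 * k) * (T + 4 * k) := by exact_mod_cast hfin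
  interval_cases k <;> nlinarith

theorem mul_card_add_le (h : Γ.IsPerronWeight s t α) (hs : 1 < s) {a b : ℝ}
    (hpa : 0 < a) (ha : ∀ x, a ≤ α x) (hb : ∀ x, α x ≤ b) (hpb : 0 < b) (hab : t - 1 ≤ a * b) :
    a * b * (Fintype.card V + s) ≤ (s + t) * ((a + b) ^ 2 + t - s) - a * b * t := by
  have hcube := h.sum_cube
  have hsq := h.sum_sq
  set e := ∑ x, α x with he
  have h1 : 0 ≤ (a + b) * e - (s - 1) * (s + t) - a * b * Fintype.card V := by
    have : 0 ≤ ∑ x, (α x - a) * (b - α x) :=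
      Finset.sum_nonneg fun x _ => mul_nonneg (sub_nonneg.2 (ha x)) (sub_nonneg.2 (hb x))
    refine this.trans_eq ?_
    rw [← hsq, he, Finset.mul_sum, Fintype.card, Finset.card_eq_sum_ones]
    push_cast
    rw [Finset.mul_sum, ← Finset.sum_sub_distrib, ← Finset.sum_sub_distrib]
    exact Finset.sum_congr rfl fun x _ => by ring
  have h2 : 0 ≤ (a + b) * ((s - 1) * (s + t)) - (s - t) * e - a * b * e := by
    have : 0 ≤ ∑ x, α x * ((α x - a) * (b - α x)) :=
      Finset.sum_nonneg fun x _ => mul_nonneg (h.pos x).le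
        (mul_nonneg (sub_nonneg.2 (ha x)) (sub_nonneg.2 (hb x)))
    refine this.trans_eq ?_
    rw [← hcube, ← hsq, he, Finset.mul_sum, Finset.mul_sum, ← Finset.sum_sub_distrib,
      ← Finset.sum_sub_distrib]
    exact Finset.sum_congr rfl fun x _ => by ring
  have h3 : (s - t + a * b) * (a * b * Fintype.card V) ≤
      (s - 1) * ((s + t) * ((a + b) ^ 2 - (s - t + a * b))) := by
    have e1 := mul_nonneg (by linarith : 0 ≤ s - t + a * b) h1
    have e2 := mul_nonneg (by linarith : 0 ≤ a + b) h2
    linarith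
  have h4 : (s - 1) * (a * b * Fintype.card V) ≤
      (s - 1) * ((s + t) * ((a + b) ^ 2 - (s - t + a * b))) := by
    refine le_trans (mul_le_mul_of_nonneg_right (by linarith) (by positivity)) h3
  have h5 := le_of_mul_le_mul_left h4 (by linarith)
  linarith

theorem sub_mul_le (h : Γ.IsPerronWeight s t α) (ht : 2 ≤ t) {z : V} (hz : ∀ x, α x ≤ α z)
    {m : ℕ} (hm : ∀ S : Finset V, (∀ x ∈ S, ∀ y ∈ S, ¬ Γ.Adj x y) → S.card ≤ m)
    (hlarge : 9 * (t - 1) < α z ^ 2) :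
    (Fintype.card V - m : ℝ) * (α z ^ 2 - 5 * (t - 1)) ≤ (s - 1) * (s + t) := by
  set b := α z with hb
  have hbpos : 0 < b := h.pos z
  have hS : (Finset.univ.filter fun x => ¬ t - 1 ≤ α x ^ 2).card ≤ m := by
    refine hm _ fun x hx y hy hadj => ?_
    simp only [Finset.mem_filter, Finset.mem_univ, true_and, not_le] at hx hy
    have h1 := h.sub_one_le_mul hadj
    nlinarith [sq_nonneg (α x - α y)]
  have hcard := Finset.card_filter_add_card_filter_not (s := (Finset.univ : Finset V))
    (fun x => t - 1 ≤ α x ^ 2)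
  rw [Finset.card_univ] at hcard
  have hT : (Fintype.card V - m : ℝ) ≤ (Finset.univ.filter fun x => t - 1 ≤ α x ^ 2).card := by
    rw [← hcard]
    push_cast
    have : ((Finset.univ.filter fun x => ¬ t - 1 ≤ α x ^ 2).card : ℝ) ≤ m := by exact_mod_cast hS
    linarith
  have hle : ∀ x ∈ Finset.univ.filter (fun x => t - 1 ≤ α x ^ 2),
      b ^ 2 - 5 * (t - 1) ≤ α x ^ 2 := by
    intro x hx
    simp only [Finset.mem_filter, Finset.mem_univ, true_and] at hx
    have h1 := h.mul_sub_le ht z x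
    rw [← hb] at h1
    have h2 := hz x
    have hxpos := h.pos x
    have h3 : 2 * b ≤ 3 * α x := by
      by_contra! h4
      have h6 : 2 * (t - 1) < α x * (b - α x) := by
        by_cases h5 : 3 * α x ≤ b
        · have h7 : 2 * α x ^ 2 ≤ α x * (b - α x) := by nlinarith
          rcases h7.lt_or_eq with h8 | h8
          · nlinarith
          · have : b - α x = 2 * α x := by
              have : α x * (b - α x - 2 * α x) = 0 := by linarith
              rcases mul_eq_zero.1 this with h | h <;> linarith
            nlinarith
        · nlinarith
      linarith
    nlinarith
  calc (Fintype.card V - m : ℝ) * (b ^ 2 - 5 * (t - 1))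
      ≤ (Finset.univ.filter fun x => t - 1 ≤ α x ^ 2).card * (b ^ 2 - 5 * (t - 1)) :=
        mul_le_mul_of_nonneg_right hT (by linarith)
    _ ≤ ∑ x ∈ Finset.univ.filter (fun x => t - 1 ≤ α x ^ 2), α x ^ 2 := by
        rw [← nsmul_eq_mul]; exact Finset.card_nsmul_le_sum _ _ _ hle
    _ ≤ ∑ x, α x ^ 2 := Finset.sum_le_sum_of_subset_of_nonneg (Finset.subset_univ _)
        fun _ _ _ => sq_nonneg _
    _ = _ := h.sum_sq

end SimpleGraph.IsPerronWeight

theorem rank_bound_of_small_weight {s t a b n m : ℝ} (ht : 30 ≤ t) (ha : 2 ≤ a)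
    (hab : a ≤ b) (hp : t - 1 ≤ a * b) (hb : b ^ 2 ≤ 9 * (t - 1)) (hs : s ≤ b ^ 2 + t)
    (hmt : t - 2 ≤ m)
    (hm : m * (t + 1) = n + s - 1) (hquad : m * (2 * t - 1 - m) ≤ 2 * s)
    (hn : a * b * (n + s) ≤ (s + t) * ((a + b) ^ 2 + t - s) - a * b * t) : False := by
  have h1 : 3 / 2 * t < m := by
    by_contra! h
    nlinarith [mul_nonneg (sub_nonneg.2 h) (by linarith : 0 ≤ m - t / 2 + 1)]
  set p := a * b with hpdef
  have hp0 : 0 < p := by linarith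
  have hp9 : p ≤ 9 * (t - 1) := by nlinarith
  have hX : (a + b) ^ 2 ≤ 8 * (t - 1) + 28 / 9 * p := by
    have e1 : 9 * (t - 1) * (a + b) ^ 2 ≤ (9 * (t - 1) + p) ^ 2 := by
      have : 0 ≤ (9 * (t - 1) - a ^ 2) * (9 * (t - 1) - b ^ 2) :=
        mul_nonneg (by nlinarith) (by linarith)
      rw [hpdef]; nlinarith
    have e2 := mul_nonneg (sub_nonneg.2 hp) (sub_nonneg.2 hp9)
    have e3 : 9 * (t - 1) * (a + b) ^ 2 ≤ 9 * (t - 1) * (8 * (t - 1) + 28 / 9 * p) := by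
      nlinarith
    exact le_of_mul_le_mul_left e3 (by linarith)
  have hX2 : ((a + b) ^ 2 + 2 * t) ^ 2 ≤ 188 * t * p := by
    have e1 : (a + b) ^ 2 + 2 * t ≤ 1007 / 100 * (t - 1) + 28 / 9 * p := by linarith
    have e2 : (1007 / 100 * (t - 1) + 28 / 9 * p) ^ 2 ≤ 188 * (t - 1) * p := by
      nlinarith [mul_nonneg (sub_nonneg.2 hp) (sub_nonneg.2 hp9)]
    have e3 : 0 ≤ (a + b) ^ 2 + 2 * t := by positivity
    calc _ ≤ (1007 / 100 * (t - 1) + 28 / 9 * p) ^ 2 := pow_le_pow_left₀ e3 e1 2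
      _ ≤ 188 * (t - 1) * p := e2
      _ ≤ _ := by nlinarith
  have h2 : p * (n + s) ≤ p * (46 * t) := by
    nlinarith [sq_nonneg ((s + t) - ((a + b) ^ 2 + t - s))]
  have h3 := le_of_mul_le_mul_left h2 hp0
  nlinarith

theorem rank_bound_of_large_weight_of_le {s t b m N : ℝ} (ht : 30 ≤ t)
    (hb : 9 * (t - 1) < b ^ 2) (hs1 : 1 < s) (hs : s ≤ b ^ 2 + t) (hmt : t - 2 ≤ m)
    (hmN : m * t = N + s - 1) (hquad : m * (2 * t - 1 - m) ≤ 2 * s)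
    (hN : N * (b ^ 2 - 5 * (t - 1)) ≤ (s - 1) * (s + t)) (hs43 : s ≤ 43 / 100 * t ^ 2) :
    False := by
  have h1 : 13 / 10 * t < m := by
    by_contra! h
    nlinarith [mul_nonneg (sub_nonneg.2 h) (by linarith : 0 ≤ m - 7 / 10 * t + 1)]
  have h2 : 13 / 10 * t ^ 2 < N + s - 1 := by rw [← hmN]; nlinarith
  have hN0 : 0 < N := by nlinarith
  by_cases hs10 : s ≤ 10 * t
  · have h3 : N * (4 * (t - 1)) ≤ (s - 1) * (s + t) :=
      (mul_le_mul_of_nonneg_left (by linarith) hN0.le).trans hN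
    have h4 : (s - 1) * (s + t) ≤ (10 * t - 1) * (11 * t) :=
      mul_le_mul (by linarith) (by linarith) (by linarith) (by linarith)
    have h5 : N ≤ 29 * t := by
      refine le_of_mul_le_mul_right (?_ : N * (4 * (t - 1)) ≤ 29 * t * (4 * (t - 1))) (by linarith)
      nlinarith
    nlinarith
  · push Not at hs10
    have h3 : N * (s - 6 * t) ≤ (s - 1) * (s + t) :=
      (mul_le_mul_of_nonneg_left (by linarith) hN0.le).trans hN
    have h4 : (13 / 10 * t ^ 2 - s) * (s - 6 * t) ≤ (s - 1) * (s + t) :=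
      (mul_le_mul_of_nonneg_right (by linarith) (by linarith)).trans h3
    have h5 := mul_nonneg (sub_nonneg.2 hs10.le) (sub_nonneg.2 hs43)
    have h6 : 0 < s * t * (15 - 44 / 100 * t) - 8 / 10 * t ^ 3 := by nlinarith
    have h7 : s * t * (15 - 44 / 100 * t) ≤ s * t * (18 / 10) :=
      mul_le_mul_of_nonneg_left (by linarith) (by positivity)
    have h8 : s * t ≤ 43 / 100 * t ^ 2 * t := mul_le_mul_of_nonneg_right hs43 (by linarith)
    have h9 : 0 < t ^ 3 := by positivity
    linarith

theorem rank_bound_of_large_weight_of_lt {s t a b n m N : ℝ} (ht : 30 ≤ t) (ha : 2 ≤ a)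
    (hat : 2 * a ≤ t) (hb0 : 0 < b) (hs : s ≤ b ^ 2 + t) (hsa : s * a ≤ b * (t + a ^ 2))
    (hnb : b ^ 2 + t + 1 ≤ n) (hNdef : N = n - m) (hmN : m * t = N + s - 1)
    (hN : N * (b ^ 2 - 5 * (t - 1)) ≤ (s - 1) * (s + t)) (hs43 : 43 / 100 * t ^ 2 < s) :
    False := by
  have hQ : s ≤ b * (17 / 30 * t) := by
    have e1 : t + a ^ 2 ≤ (17 / 30 * t) * a := by nlinarith
    refine le_of_mul_le_mul_right (?_ : s * a ≤ b * (17 / 30 * t) * a) (by linarith)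
    calc s * a ≤ b * (t + a ^ 2) := hsa
      _ ≤ b * (17 / 30 * t * a) := mul_le_mul_of_nonneg_left e1 hb0.le
      _ = _ := by ring
  have hbt : 758 / 1000 * t ≤ b := by
    by_contra! h
    nlinarith
  have hB : 574 / 1000 * t ^ 2 ≤ b ^ 2 := by nlinarith
  have ht2 : 30 * t ≤ t ^ 2 := by nlinarith
  have ht3 : 30 * t ^ 2 ≤ t ^ 3 := by nlinarith
  have h1 : s + t ≤ 1078 / 1000 * s := by nlinarith
  have h2 : s ^ 2 ≤ b ^ 2 * (17 / 30 * t) ^ 2 := by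
    rw [← mul_pow]; exact pow_le_pow_left₀ (by linarith) hQ 2
  have h3 : (s - 1) * (s + t) ≤ 3462 / 10000 * t ^ 2 * b ^ 2 := by
    have : (s - 1) * (s + t) ≤ s * (1078 / 1000 * s) :=
      mul_le_mul (by linarith) h1 (by linarith) (by linarith)
    nlinarith [mul_nonneg (sq_nonneg t) (sq_nonneg b)]
  have h4 : 7096 / 10000 * b ^ 2 ≤ b ^ 2 - 5 * (t - 1) := by linarith
  have h5 : N ≤ 488 / 1000 * t ^ 2 := by
    by_contra! h
    have hN0 : 0 < N := lt_of_le_of_lt (by positivity) h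
    have e1 := (mul_le_mul_of_nonneg_left h4 hN0.le).trans (hN.trans h3)
    have hb2 : 0 < b ^ 2 := by positivity
    have e2 : (N * (7096 / 10000)) * b ^ 2 ≤ (3462 / 10000 * t ^ 2) * b ^ 2 := by linarith
    have e3 := le_of_mul_le_mul_right e2 hb2
    have : 0 < t ^ 2 := by positivity
    linarith
  have h6 : N * (t + 1) + s - 1 = n * t := by
    linear_combination t * hNdef - hmN
  have h7 : t * (b ^ 2 + t + 1) ≤ N * (t + 1) + s - 1 := by rw [h6]; nlinarith
  have h8 : N * (t + 1) ≤ 488 / 1000 * t ^ 2 * (31 / 30 * t) :=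
    mul_le_mul h5 (by linarith) (by linarith) (by positivity)
  have h9 : (t - 1) * (574 / 1000 * t ^ 2) ≤ (t - 1) * b ^ 2 :=
    mul_le_mul_of_nonneg_left hB (by linarith)
  linarith

theorem rank_bound_of_large_weight {s t a b n m : ℝ} (ht : 30 ≤ t) (ha : 2 ≤ a)
    (hat : 2 * a ≤ t) (hb0 : 0 < b) (hb : 9 * (t - 1) < b ^ 2) (hs1 : 1 < s)
    (hs : s ≤ b ^ 2 + t) (hsa : s * a ≤ b * (t + a ^ 2)) (hnb : b ^ 2 + t + 1 ≤ n)
    (hmt : t - 2 ≤ m)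
    (hm : m * (t + 1) = n + s - 1) (hquad : m * (2 * t - 1 - m) ≤ 2 * s)
    (hN : (n - m) * (b ^ 2 - 5 * (t - 1)) ≤ (s - 1) * (s + t)) : False := by
  obtain ⟨N, hNdef⟩ : ∃ N, N = n - m := ⟨_, rfl⟩
  rw [← hNdef] at hN
  have hmN : m * t = N + s - 1 := by rw [hNdef]; linarith
  rcases le_or_gt s (43 / 100 * t ^ 2) with hs43 | hs43
  · exact rank_bound_of_large_weight_of_le ht hb hs1 hs hmt hmN hquad hN hs43
  · exact rank_bound_of_large_weight_of_lt ht ha hat hb0 hs hsa hnb hNdef hmN hN hs43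

theorem SimpleGraph.exists_ne_not_adj_of_not_cone {V : Type*} [Fintype V] [DecidableEq V]
    (Γ : SimpleGraph V) [DecidableRel Γ.Adj] [Nonempty V]
    (h : ¬ ∃ v : V, Γ.degree v = Fintype.card V - 1) : ∃ x y, x ≠ y ∧ ¬ Γ.Adj x y := by
  by_contra! hall
  obtain ⟨v⟩ := ‹Nonempty V›
  refine h ⟨v, ?_⟩
  have : Γ.neighborFinset v = Finset.univ.erase v := by
    ext y
    simp only [SimpleGraph.mem_neighborFinset, Finset.mem_erase, Finset.mem_univ, and_true]
    exact ⟨fun hy => hy.ne', fun hy => hall v y hy.symm⟩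
  rw [← SimpleGraph.card_neighborFinset_eq_degree, this, Finset.card_erase_of_mem (Finset.mem_univ v),
    Finset.card_univ]

/-- A graph in H′(s,t) with at least 5 distinct vertex degrees has t ≤ 29. -/
theorem H'_st_five_valencies_t_le_29
    {V : Type} [Fintype V] [DecidableEq V] (Γ : SimpleGraph V) [DecidableRel Γ.Adj]
    (s t : ℝ)
    (hconn : Γ.Connected)
    (hnonreg : ¬ ∃ k, Γ.IsRegularOfDegree k)
    (hs : 1 < s) (ht : -t < 1)
    (hspec : spectrum ℝ (Γ.adjMatrix ℝ) = {s, 1, -t})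
    (hnotcone : ¬ ∃ v : V, Γ.degree v = Fintype.card V - 1)
    (hnotbireg : ((Finset.univ : Finset V).image (fun v => Γ.degree v)).card ≠ 2)
    (hval : 5 ≤ ((Finset.univ : Finset V).image (fun v => Γ.degree v)).card) :
    t ≤ 29 := by
  by_contra! h29
  obtain ⟨α, h, m, hm, hbell, hindep⟩ := Γ.exists_isPerronWeight hconn hs (by linarith) hspec
  have hne := hconn.nonempty
  obtain ⟨x, y, hxy, hadj⟩ := Γ.exists_ne_not_adj_of_not_cone hnotcone
  obtain ⟨T, hT⟩ := h.exists_int_eq_of_rank (by linarith) hm hxy hadj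
  have ht30 : 30 ≤ t := by
    rw [hT] at h29 ⊢
    have : 29 < T := by exact_mod_cast h29
    exact_mod_cast (by omega : 30 ≤ T)
  obtain ⟨u, -, hu⟩ := Finset.exists_min_image Finset.univ α Finset.univ_nonempty
  obtain ⟨z, -, hz⟩ := Finset.exists_max_image Finset.univ α Finset.univ_nonempty
  replace hu : ∀ x, α u ≤ α x := fun x => hu x (Finset.mem_univ x)
  replace hz : ∀ x, α x ≤ α z := fun x => hz x (Finset.mem_univ x)
  obtain ⟨v, hv⟩ : ∃ v : Fin 5 → V, ∀ i j, i < j → α (v i) < α (v j) := by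
    have hmem := Finset.orderEmbOfCardLe_mem _ hval
    choose v hv using fun i => Finset.mem_image.1 (hmem i)
    refine ⟨v, fun i j hij => h.lt_of_degree_lt ?_⟩
    rw [(hv i).2, (hv j).2]
    exact (Finset.orderEmbOfCardLe _ hval).strictMono hij
  have hnt : Nontrivial V := ⟨x, y, hxy⟩
  obtain ⟨w, hw⟩ := hconn.preconnected.exists_adj_of_nontrivial u
  have hupos := h.pos u
  have hzpos := h.pos z
  have ha2 : 2 ≤ α u := by
    have := h.four_le_sq hT ht30 hu hz hv ⟨w, hw⟩
    nlinarith
  have hab4 : α u + 4 ≤ α z := by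
    have h1 := h.add_one_le_of_lt hT (hv 0 1 (by decide))
    have h2 := h.add_one_le_of_lt hT (hv 1 2 (by decide))
    have h3 := h.add_one_le_of_lt hT (hv 2 3 (by decide))
    have h4 := h.add_one_le_of_lt hT (hv 3 4 (by decide))
    linarith [hu (v 0), hz (v 4)]
  have hat : 2 * α u ≤ t := by
    have := h.mul_sub_le (by linarith) z u
    nlinarith
  have hab : t - 1 ≤ α u * α z :=
    (h.sub_one_le_mul hw).trans (mul_le_mul_of_nonneg_left (hz w) hupos.le)
  have hsa := h.mul_le_of_le hz u
  have hsb : s ≤ α z ^ 2 + t := by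
    have := h.mul_le_of_le hz z
    rw [mul_comm] at this
    linarith [le_of_mul_le_mul_left this hzpos]
  have hn : α z ^ 2 + t + 1 ≤ Fintype.card V := by
    have h1 : (Γ.degree z : ℝ) + 1 ≤ Fintype.card V := by exact_mod_cast Γ.degree_lt_card_verts z
    rw [h.degree_eq] at h1
    linarith
  have hquad : (m : ℝ) * (2 * t - 1 - m) ≤ 2 * s := by
    have : (2 * Fintype.card V : ℝ) ≤ (m + 1) * (m + 2) := by exact_mod_cast hbell
    nlinarith
  have hm0 : (0 : ℝ) < m := by
    by_contra! hle
    nlinarith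
  have hmt : t - 2 ≤ m := by
    have h1 : (m : ℝ) * (2 * t - 1 - m) ≤ m * (t + 1) := by linarith
    linarith [le_of_mul_le_mul_left h1 hm0]
  rcases le_or_gt (α z ^ 2) (9 * (t - 1)) with hb | hb
  · exact rank_bound_of_small_weight ht30 ha2 (hu z) hab hb hsb hmt hm hquad
      (h.mul_card_add_le hs hupos hu hz hzpos hab)
  · exact rank_bound_of_large_weight ht30 ha2 hat hzpos hb hs hsb hsa hn hmt hm hquad
      (h.sub_mul_le (by linarith) hz hindep hb)
end
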